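/- arXiv:2401.14790 — 3 statements merged into one kernel-verified Lean document; each statement's English description precedes it below -/
import Mathlib

section
/- Let A be a commutative ring in which the positive integer n is invertible, let M be an A-module, B = Sym_A(M), and let D : B → B be the derivation acting as multiplication by d on Sym^d(M). Then the degree-n homogeneous component of the Koszul complex (⋀^•_B Ω_{B/A}, i_D) is acyclic; more concretely, the complex 0 → ⋀^n M → ⋀^{n-1} M ⊗ Sym^1 M → ⋯ → ⋀^p M ⊗ Sym^{n-p} M → ⋯ → Sym^n M → 0 is exact, the differential sending (m_1∧⋯∧m_p) ⊗ s to Σ_i (−1)^{i+1} m_1∧⋯∧m̂_i∧⋯∧m_p ⊗ (m_i·s). -/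
/-! The symmetric algebra of a module, realized as a quotient of the tensor algebra. -/

variable (A : Type) [CommRing A] (M : Type) [AddCommGroup M] [Module A M]

/-- The relation imposing commutativity of elements of `M` in the tensor algebra. -/
inductive SymRel : TensorAlgebra A M → TensorAlgebra A M → Prop
  | mul_comm (m m' : M) :
      SymRel (TensorAlgebra.ι A m * TensorAlgebra.ι A m')
        (TensorAlgebra.ι A m' * TensorAlgebra.ι A m)

/-- The symmetric algebra `Sym_A(M)`. -/
def SymmAlg := RingQuot (SymRel A M)

instance : Ring (SymmAlg A M) := inferInstanceAs (Ring (RingQuot (SymRel A M)))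
instance : Algebra A (SymmAlg A M) := inferInstanceAs (Algebra A (RingQuot (SymRel A M)))

/-- The projection from the tensor algebra onto the symmetric algebra. -/
noncomputable def SymmAlg.mk : TensorAlgebra A M →ₐ[A] SymmAlg A M :=
  RingQuot.mkAlgHom A (SymRel A M)

theorem SymmAlg.mk_mul_comm (a : TensorAlgebra A M) :
    ∀ b, SymmAlg.mk A M a * SymmAlg.mk A M b = SymmAlg.mk A M b * SymmAlg.mk A M a := by
  induction a using TensorAlgebra.induction with
  | algebraMap r => intro b; rw [AlgHom.commutes]; exact Algebra.commutes r _
  | ι m =>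
    intro b
    induction b using TensorAlgebra.induction with
    | algebraMap r => rw [AlgHom.commutes]; exact (Algebra.commutes r _).symm
    | ι m' =>
      have h := RingQuot.mkAlgHom_rel A (SymRel.mul_comm (A := A) (M := M) m m')
      rw [map_mul, map_mul] at h
      exact h
    | mul x y hx hy =>
      calc SymmAlg.mk A M (TensorAlgebra.ι A m) * SymmAlg.mk A M (x * y)
          = SymmAlg.mk A M (TensorAlgebra.ι A m) * (SymmAlg.mk A M x * SymmAlg.mk A M y) := by
            rw [map_mul]
        _ = (SymmAlg.mk A M (TensorAlgebra.ι A m) * SymmAlg.mk A M x) * SymmAlg.mk A M y :=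
            (mul_assoc _ _ _).symm
        _ = (SymmAlg.mk A M x * SymmAlg.mk A M (TensorAlgebra.ι A m)) * SymmAlg.mk A M y := by
            rw [hx]
        _ = SymmAlg.mk A M x * (SymmAlg.mk A M (TensorAlgebra.ι A m) * SymmAlg.mk A M y) :=
            mul_assoc _ _ _
        _ = SymmAlg.mk A M x * (SymmAlg.mk A M y * SymmAlg.mk A M (TensorAlgebra.ι A m)) := by
            rw [hy]
        _ = (SymmAlg.mk A M x * SymmAlg.mk A M y) * SymmAlg.mk A M (TensorAlgebra.ι A m) :=
            (mul_assoc _ _ _).symm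
        _ = SymmAlg.mk A M (x * y) * SymmAlg.mk A M (TensorAlgebra.ι A m) := by rw [map_mul]
    | add x y hx hy => rw [map_add, mul_add, add_mul, hx, hy]
  | mul x y hx hy =>
    intro b
    calc SymmAlg.mk A M (x * y) * SymmAlg.mk A M b
        = SymmAlg.mk A M x * (SymmAlg.mk A M y * SymmAlg.mk A M b) := by
          rw [map_mul, mul_assoc]
      _ = SymmAlg.mk A M x * (SymmAlg.mk A M b * SymmAlg.mk A M y) := by rw [hy]
      _ = (SymmAlg.mk A M x * SymmAlg.mk A M b) * SymmAlg.mk A M y := (mul_assoc _ _ _).symm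
      _ = (SymmAlg.mk A M b * SymmAlg.mk A M x) * SymmAlg.mk A M y := by rw [hx]
      _ = SymmAlg.mk A M b * SymmAlg.mk A M (x * y) := by rw [map_mul, mul_assoc]
  | add x y hx hy => intro b; rw [map_add, add_mul, mul_add, hx, hy]

noncomputable instance : CommRing (SymmAlg A M) :=
  { (inferInstance : Ring (SymmAlg A M)) with
    mul_comm := fun a b => by
      obtain ⟨a, rfl⟩ := RingQuot.mkAlgHom_surjective A (SymRel A M) a
      obtain ⟨b, rfl⟩ := RingQuot.mkAlgHom_surjective A (SymRel A M) b
      exact SymmAlg.mk_mul_comm A M a b }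

/-- The canonical inclusion of `M` into the symmetric algebra. -/
noncomputable def SymmAlg.ι : M →ₗ[A] SymmAlg A M :=
  (SymmAlg.mk A M).toLinearMap ∘ₗ TensorAlgebra.ι A

open scoped TensorProduct

/-- The `q`-th symmetric power of `M`, as the degree-`q` component of `Sym_A(M)`. -/
noncomputable def SymPow (q : ℕ) : Submodule A (SymmAlg A M) := (LinearMap.range (SymmAlg.ι A M)) ^ q

/-- The wedge `m_1 ∧ ⋯ ∧ m_p` as an element of the `p`-th exterior power. -/
noncomputable def wedge (p : ℕ) (m : Fin p → M) : ⋀[A]^p M :=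
  ⟨ExteriorAlgebra.ιMulti A p m, ExteriorAlgebra.ιMulti_range A p (Set.mem_range_self m)⟩

/-- Multiplication `Sym^q(M) → Sym^{q+1}(M)` by an element `m ∈ M`. -/
noncomputable def mulBy (m : M) (q : ℕ) : SymPow A M q →ₗ[A] SymPow A M (q + 1) where
  toFun s := ⟨SymmAlg.ι A M m * (s : SymmAlg A M), by
    have h := Submodule.mul_mem_mul (LinearMap.mem_range_self (SymmAlg.ι A M) m) s.2
    show _ ∈ (LinearMap.range (SymmAlg.ι A M)) ^ (q + 1)
    rw [pow_succ']
    exact h⟩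
  map_add' s t := by apply Subtype.ext; simp [mul_add]
  map_smul' a s := by apply Subtype.ext; simp [Algebra.mul_smul_comm]

namespace KoszulComplex

/-- The degree `(p, q)` term `⋀ᵖM ⊗ SymᵠM` of the Koszul complex. -/
abbrev Term (p q : ℕ) : Type := (⋀[A]^p M) ⊗[A] (SymPow A M q)

/-- Left exterior multiplication by an element of `M`. -/
noncomputable def wedgeLeft (p : ℕ) : M →ₗ[A] ⋀[A]^p M →ₗ[A] ⋀[A]^(p+1) M :=
  LinearMap.mk₂ A
    (fun m x => ⟨ExteriorAlgebra.ι A m * (x : ExteriorAlgebra A M), by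
      have h := Submodule.mul_mem_mul
        (LinearMap.mem_range_self (ExteriorAlgebra.ι A (M := M)) m) x.2
      rwa [← pow_succ'] at h⟩)
    (fun m m' x => Subtype.ext (by simp [add_mul]))
    (fun c m x => Subtype.ext (by simp))
    (fun m x y => Subtype.ext (by simp [mul_add]))
    (fun c m x => Subtype.ext (by simp))

theorem wedgeLeft_wedge (p : ℕ) (m : M) (v : Fin p → M) :
    wedgeLeft A M p m (wedge A M p v) = wedge A M (p+1) (Matrix.vecCons m v) :=
  Subtype.ext <| by
    simp [wedgeLeft, wedge, ExteriorAlgebra.ιMulti_succ_apply, Matrix.vecTail, Function.comp_def]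

/-- Left exterior multiplication on `⋀ᵖM ⊗ SymᵠM`. -/
noncomputable def extMul (p q : ℕ) : M →ₗ[A] Term A M p q →ₗ[A] Term A M (p+1) q :=
  LinearMap.rTensorHom (SymPow A M q) ∘ₗ wedgeLeft A M p

theorem extMul_tmul (p q : ℕ) (m : M) (w : ⋀[A]^p M) (s : SymPow A M q) :
    extMul A M p q m (w ⊗ₜ s) = wedgeLeft A M p m w ⊗ₜ s := rfl

/-- Multiplication by elements of `M` on symmetric powers, as a bilinear map. -/
noncomputable def mulByHom (q : ℕ) : M →ₗ[A] SymPow A M q →ₗ[A] SymPow A M (q+1) where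
  toFun m := mulBy A M m q
  map_add' m m' := by
    ext s
    simp [mulBy, add_mul]
  map_smul' c m := by
    ext s
    simp [mulBy]

/-- Symmetric multiplication on `⋀ᵖM ⊗ SymᵠM`. -/
noncomputable def symMul (p q : ℕ) : M →ₗ[A] Term A M p q →ₗ[A] Term A M p (q+1) :=
  LinearMap.lTensorHom (⋀[A]^p M) ∘ₗ mulByHom A M q

theorem symMul_tmul (p q : ℕ) (m : M) (w : ⋀[A]^p M) (s : SymPow A M q) :
    symMul A M p q m (w ⊗ₜ s) = w ⊗ₜ mulBy A M m q s := rfl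

/-- The unit of the symmetric algebra, in degree zero. -/
noncomputable def symOne : SymPow A M 0 := ⟨1, by
  show (1 : SymmAlg A M) ∈ (LinearMap.range (SymmAlg.ι A M)) ^ 0
  rw [pow_zero]
  exact Submodule.one_le.1 le_rfl⟩

theorem mulBy_comm (q : ℕ) (m m' : M) (s : SymPow A M q) :
    mulBy A M m (q+1) (mulBy A M m' q s) = mulBy A M m' (q+1) (mulBy A M m q s) :=
  Subtype.ext (mul_left_comm _ _ _)

variable {A M} in
theorem symPow_zero_ext {N : Type} [AddCommMonoid N] [Module A N] {f g : SymPow A M 0 →ₗ[A] N}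
    (h : f (symOne A M) = g (symOne A M)) : f = g := by
  ext ⟨s, hs⟩
  have hs' : s ∈ (1 : Submodule A (SymmAlg A M)) := by
    rw [← pow_zero (LinearMap.range (SymmAlg.ι A M))]
    exact hs
  obtain ⟨a, rfl⟩ := Submodule.mem_one.1 hs'
  have : (⟨algebraMap A (SymmAlg A M) a, hs⟩ : SymPow A M 0) = a • symOne A M :=
    Subtype.ext (Algebra.algebraMap_eq_smul_one a)
  rw [this, map_smul, map_smul, h]

variable {A M} in
theorem symPow_succ_ext {N : Type} [AddCommMonoid N] [Module A N] {q : ℕ}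
    {f g : SymPow A M (q+1) →ₗ[A] N}
    (h : ∀ m s, f (mulBy A M m q s) = g (mulBy A M m q s)) : f = g := by
  ext ⟨s, hs⟩
  have hs' : s ∈ LinearMap.range (SymmAlg.ι A M) * LinearMap.range (SymmAlg.ι A M) ^ q := by
    rw [← pow_succ']
    exact hs
  suffices ∃ hs : s ∈ SymPow A M (q+1), f ⟨s, hs⟩ = g ⟨s, hs⟩ from this.2
  clear hs
  induction hs' using Submodule.mul_induction_on' with
  | mem_mul_mem x hx y hy =>
    obtain ⟨m, rfl⟩ := hx
    exact ⟨(mulBy A M m q ⟨y, hy⟩).2, h m ⟨y, hy⟩⟩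
  | add x _ y _ hx hy =>
    obtain ⟨hx, ex⟩ := hx
    obtain ⟨hy, ey⟩ := hy
    refine ⟨add_mem hx hy, ?_⟩
    have : (⟨x + y, add_mem hx hy⟩ : SymPow A M (q+1)) = ⟨x, hx⟩ + ⟨y, hy⟩ := rfl
    rw [this, map_add, map_add, ex, ey]

variable {A M} in
theorem exteriorPower_ext {N : Type} [AddCommMonoid N] [Module A N] {p : ℕ}
    {f g : ⋀[A]^p M →ₗ[A] N} (h : ∀ v, f (wedge A M p v) = g (wedge A M p v)) : f = g :=
  LinearMap.ext_on_range (exteriorPower.ιMulti_span A p M) h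

section Ext

variable {A M}
variable {N : Type} [AddCommMonoid N] [Module A N] {p q : ℕ}

theorem term_ext {f g : Term A M p q →ₗ[A] N}
    (h : ∀ v s, f (wedge A M p v ⊗ₜ s) = g (wedge A M p v ⊗ₜ s)) : f = g :=
  TensorProduct.ext <| exteriorPower_ext fun v => LinearMap.ext fun s => h v s

theorem term_sym_zero_ext {f g : Term A M p 0 →ₗ[A] N}
    (h : ∀ v, f (wedge A M p v ⊗ₜ symOne A M) = g (wedge A M p v ⊗ₜ symOne A M)) : f = g :=
  TensorProduct.ext <| exteriorPower_ext fun v => symPow_zero_ext (h v)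

theorem term_sym_succ_ext {f g : Term A M p (q+1) →ₗ[A] N}
    (h : ∀ m x, f (symMul A M p q m x) = g (symMul A M p q m x)) : f = g :=
  TensorProduct.ext <| LinearMap.ext fun w => symPow_succ_ext fun m s => h m (w ⊗ₜ s)

theorem term_ext_succ_ext {f g : Term A M (p+1) q →ₗ[A] N}
    (h : ∀ m x, f (extMul A M p q m x) = g (extMul A M p q m x)) : f = g :=
  term_ext fun v s => by
    have := h (v 0) (wedge A M p (Matrix.vecTail v) ⊗ₜ s)
    have hv : Matrix.vecCons (v 0) (Matrix.vecTail v) = v := Matrix.cons_head_tail v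
    rwa [extMul_tmul, wedgeLeft_wedge, hv] at this

end Ext

theorem symMul_comm (p q : ℕ) (m m' : M) (x : Term A M p q) :
    symMul A M p (q+1) m (symMul A M p q m' x) = symMul A M p (q+1) m' (symMul A M p q m x) := by
  induction x using TensorProduct.induction_on with
  | zero => simp
  | tmul w s => simp only [symMul_tmul, mulBy_comm]
  | add x y hx hy => simp only [map_add, hx, hy]

theorem extMul_symMul (p q : ℕ) (m m' : M) (x : Term A M p q) :
    extMul A M p (q+1) m (symMul A M p q m' x) = symMul A M (p+1) q m' (extMul A M p q m x) := by
  induction x using TensorProduct.induction_on with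
  | zero => simp
  | tmul w s => rfl
  | add x y hx hy => simp only [map_add, hx, hy]

/-- Symmetric multiplication on families indexed by the symmetric degree. -/
noncomputable def shiftMul (p : ℕ) : M →ₗ[A] Module.End A (∀ q, Term A M p q) :=
  LinearMap.mk₂ A
    (fun m x q => match q with
      | 0 => 0
      | q+1 => symMul A M p q m (x q))
    (fun m m' x => by funext q; cases q <;> simp)
    (fun c m x => by funext q; cases q <;> simp)
    (fun m x y => by funext q; cases q <;> simp)
    (fun c m x => by funext q; cases q <;> simp)

theorem shiftMul_zero (p : ℕ) (m : M) (x : ∀ q, Term A M p q) : shiftMul A M p m x 0 = 0 := rfl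

theorem shiftMul_succ (p : ℕ) (m : M) (x : ∀ q, Term A M p q) (q : ℕ) :
    shiftMul A M p m x (q+1) = symMul A M p q m (x q) := rfl

/-- The first-order thickening on which `Sym M` acts with the derivation as its second
component. -/
abbrev Thickening (p : ℕ) : Type := (∀ q, Term A M p q) × (∀ q, Term A M (p+1) q)

/-- The action of `m ∈ M` on the thickening: `(x, y) ↦ (m x, m ∧ x + m y)`. -/
noncomputable def thickMul (p : ℕ) : M →ₗ[A] Module.End A (Thickening A M p) :=
  LinearMap.mk₂ A
    (fun m z => (shiftMul A M p m z.1,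
      (fun q => extMul A M p q m (z.1 q)) + shiftMul A M (p+1) m z.2))
    (fun m m' z => by
      ext q <;> simp
      abel)
    (fun c m z => by ext q <;> simp)
    (fun m z z' => by
      ext q <;> simp
      abel)
    (fun c m z => by ext q <;> simp)

theorem thickMul_apply (p : ℕ) (m : M) (z : Thickening A M p) :
    thickMul A M p m z = (shiftMul A M p m z.1,
      (fun q => extMul A M p q m (z.1 q)) + shiftMul A M (p+1) m z.2) := rfl

theorem shiftMul_comm (p : ℕ) (m m' : M) (x : ∀ q, Term A M p q) :
    shiftMul A M p m (shiftMul A M p m' x) = shiftMul A M p m' (shiftMul A M p m x) := by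
  funext q
  rcases q with _ | _ | q
  · rfl
  · simp [shiftMul_succ, shiftMul_zero]
  · exact symMul_comm A M p q m m' (x q)

theorem thickMul_comm (p : ℕ) (m m' : M) (z : Thickening A M p) :
    thickMul A M p m (thickMul A M p m' z) = thickMul A M p m' (thickMul A M p m z) := by
  refine Prod.ext (shiftMul_comm A M p m m' z.1) ?_
  simp only [thickMul_apply, map_add]
  rw [shiftMul_comm A M (p+1) m m' z.2, ← add_assoc, ← add_assoc]
  congr 1
  funext q
  cases q with
  | zero => simp [shiftMul_zero]
  | succ q =>
    simp only [Pi.add_apply, shiftMul_succ, extMul_symMul]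
    exact add_comm _ _

/-- The action of the symmetric algebra on the thickening. -/
noncomputable def thickAction (p : ℕ) : SymmAlg A M →ₐ[A] Module.End A (Thickening A M p) :=
  RingQuot.liftAlgHom A ⟨TensorAlgebra.lift A (thickMul A M p), by
    rintro _ _ ⟨m, m'⟩
    refine LinearMap.ext fun z => ?_
    simpa using thickMul_comm A M p m m' z⟩

theorem thickAction_ι (p : ℕ) (m : M) :
    thickAction A M p (SymmAlg.ι A M m) = thickMul A M p m :=
  (RingQuot.liftAlgHom_mkAlgHom_apply _ _ _ _).trans (TensorAlgebra.lift_ι_apply _ _)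

/-- The embedding of `⋀ᵖM` in degree zero of the thickening. -/
noncomputable def thickInit (p : ℕ) : ⋀[A]^p M →ₗ[A] Thickening A M p :=
  LinearMap.inl A _ _ ∘ₗ LinearMap.single A (fun q => Term A M p q) 0 ∘ₗ
    (TensorProduct.mk A _ _).flip (symOne A M)

/-- The map `w ⊗ s ↦ s · w` from `⋀ᵖM ⊗ SymᵠM` to the thickening. -/
noncomputable def toThickening (p q : ℕ) : Term A M p q →ₗ[A] Thickening A M p :=
  TensorProduct.lift
    (((thickAction A M p).toLinearMap ∘ₗ (SymPow A M q).subtype).flip ∘ₗ thickInit A M p)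

theorem toThickening_tmul (p q : ℕ) (w : ⋀[A]^p M) (s : SymPow A M q) :
    toThickening A M p q (w ⊗ₜ s) = thickAction A M p s (thickInit A M p w) := rfl

theorem toThickening_symMul (p q : ℕ) (m : M) (x : Term A M p q) :
    toThickening A M p (q+1) (symMul A M p q m x) =
      thickMul A M p m (toThickening A M p q x) := by
  induction x using TensorProduct.induction_on with
  | zero => simp
  | tmul w s =>
    rw [symMul_tmul, toThickening_tmul, toThickening_tmul]
    change thickAction A M p (SymmAlg.ι A M m * s) _ = _
    rw [map_mul, thickAction_ι]
    rfl
  | add x y hx hy => simp only [map_add, hx, hy]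

theorem toThickening_symOne (p : ℕ) (w : ⋀[A]^p M) :
    toThickening A M p 0 (w ⊗ₜ symOne A M) = thickInit A M p w := by
  rw [toThickening_tmul]
  change thickAction A M p 1 _ = _
  rw [map_one]
  rfl

theorem toThickening_fst (p q : ℕ) (x : Term A M p q) : (toThickening A M p q x).1 q = x := by
  suffices LinearMap.proj q ∘ₗ LinearMap.fst A _ _ ∘ₗ toThickening A M p q = LinearMap.id from
    LinearMap.congr_fun this x
  clear x
  induction q with
  | zero =>
    refine term_sym_zero_ext fun v => ?_
    simp [toThickening_symOne, thickInit]
  | succ q ih =>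
    refine term_sym_succ_ext fun m x => ?_
    have := LinearMap.congr_fun ih x
    simp only [LinearMap.comp_apply, LinearMap.fst_apply, LinearMap.proj_apply,
      LinearMap.id_apply] at this ⊢
    rw [toThickening_symMul, thickMul_apply]
    exact (shiftMul_succ A M p m _ q).trans (by rw [this])

/-- The contracting homotopy, given by the de Rham differential. -/
noncomputable def homotopy (p q : ℕ) : Term A M p (q+1) →ₗ[A] Term A M (p+1) q :=
  LinearMap.proj q ∘ₗ LinearMap.snd A _ _ ∘ₗ toThickening A M p (q+1)

theorem homotopy_symMul_zero (p : ℕ) (m : M) (x : Term A M p 0) :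
    homotopy A M p 0 (symMul A M p 0 m x) = extMul A M p 0 m x := by
  simp [homotopy, toThickening_symMul, thickMul_apply, shiftMul_zero, toThickening_fst]

theorem homotopy_symMul_succ (p q : ℕ) (m : M) (x : Term A M p (q+1)) :
    homotopy A M p (q+1) (symMul A M p (q+1) m x) =
      extMul A M p (q+1) m x + symMul A M (p+1) q m (homotopy A M p q x) := by
  simp [homotopy, toThickening_symMul, thickMul_apply, shiftMul_succ, toThickening_fst]

/-- The defining formula of the Koszul differential. -/
def IsDifferential (δ : ∀ p q : ℕ, Term A M (p+1) q →ₗ[A] Term A M p (q+1)) : Prop :=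
  ∀ (p q : ℕ) (m : Fin (p+1) → M) (s : SymPow A M q),
    δ p q ((wedge A M (p+1) m) ⊗ₜ[A] s) =
      ∑ i : Fin (p+1), ((-1 : ℤ) ^ (i : ℕ)) •
        ((wedge A M p (m ∘ i.succAbove)) ⊗ₜ[A] (mulBy A M (m i) q s))

namespace IsDifferential

variable {A M}
variable {δ : ∀ p q : ℕ, Term A M (p+1) q →ₗ[A] Term A M p (q+1)}

theorem apply_symMul (hδ : IsDifferential A M δ) (p q : ℕ) (m : M) (x : Term A M (p+1) q) :
    δ p (q+1) (symMul A M (p+1) q m x) = symMul A M p (q+1) m (δ p q x) := by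
  suffices δ p (q+1) ∘ₗ symMul A M (p+1) q m = symMul A M p (q+1) m ∘ₗ δ p q from
    LinearMap.congr_fun this x
  refine term_ext fun v s => ?_
  simp only [LinearMap.comp_apply, symMul_tmul, hδ p, map_sum, map_zsmul, mulBy_comm A M q m]

theorem apply_extMul_zero (hδ : IsDifferential A M δ) (q : ℕ) (m : M) (x : Term A M 0 q) :
    δ 0 q (extMul A M 0 q m x) = symMul A M 0 q m x := by
  suffices δ 0 q ∘ₗ extMul A M 0 q m = symMul A M 0 q m from LinearMap.congr_fun this x
  refine term_ext fun v s => ?_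
  rw [LinearMap.comp_apply, extMul_tmul, wedgeLeft_wedge, hδ, symMul_tmul, Fin.sum_univ_one,
    Subsingleton.elim (Matrix.vecCons m v ∘ Fin.succAbove 0) v]
  simp

theorem apply_extMul_succ (hδ : IsDifferential A M δ) (p q : ℕ) (m : M)
    (x : Term A M (p+1) q) :
    δ (p+1) q (extMul A M (p+1) q m x) =
      symMul A M (p+1) q m x - extMul A M p (q+1) m (δ p q x) := by
  suffices δ (p+1) q ∘ₗ extMul A M (p+1) q m + extMul A M p (q+1) m ∘ₗ δ p q =
      symMul A M (p+1) q m from eq_sub_of_add_eq (LinearMap.congr_fun this x)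
  refine term_ext fun v s => ?_
  have hcons (i : Fin (p+1)) : Matrix.vecCons m v ∘ i.succ.succAbove =
      Matrix.vecCons m (v ∘ i.succAbove) := by
    funext j
    cases j using Fin.cases <;> simp
  have hcons_zero : Matrix.vecCons m v ∘ Fin.succAbove 0 = v := by
    funext j
    simp
  simp only [LinearMap.comp_apply, LinearMap.add_apply, extMul_tmul, wedgeLeft_wedge, hδ (p+1),
    hδ p, symMul_tmul, map_sum, map_zsmul]
  rw [Fin.sum_univ_succ, add_assoc, ← Finset.sum_add_distrib, hcons_zero,
    Finset.sum_eq_zero fun i _ => ?_]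
  · simp
  · rw [hcons, Matrix.cons_val_succ, Fin.val_succ, pow_succ, mul_neg_one, neg_smul,
      neg_add_cancel]

theorem apply_apply (hδ : IsDifferential A M δ) (p q : ℕ) (x : Term A M (p+1+1) q) :
    δ p (q+1) (δ (p+1) q x) = 0 := by
  suffices δ p (q+1) ∘ₗ δ (p+1) q = 0 from LinearMap.congr_fun this x
  clear x
  induction p with
  | zero =>
    refine term_ext_succ_ext fun m x => ?_
    suffices (δ 0 (q+1) ∘ₗ δ 1 q) ∘ₗ extMul A M 1 q m = 0 from LinearMap.congr_fun this x
    refine term_ext_succ_ext fun m' y => ?_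
    simp only [LinearMap.comp_apply, LinearMap.zero_apply]
    rw [hδ.apply_extMul_succ, map_sub, hδ.apply_symMul, hδ.apply_extMul_zero,
      hδ.apply_extMul_zero, sub_self]
  | succ p ih =>
    refine term_ext_succ_ext fun m x => ?_
    simp only [LinearMap.comp_apply, LinearMap.zero_apply]
    rw [hδ.apply_extMul_succ, map_sub, hδ.apply_symMul, hδ.apply_extMul_succ, sub_sub_cancel]
    exact (congrArg _ (LinearMap.congr_fun ih x)).trans (map_zero _)

theorem homotopy_apply_sym_zero (hδ : IsDifferential A M δ) (p : ℕ) (x : Term A M (p+1) 0) :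
    homotopy A M p 0 (δ p 0 x) = (p + 1 : A) • x := by
  suffices homotopy A M p 0 ∘ₗ δ p 0 = (p + 1 : A) • LinearMap.id from
    LinearMap.congr_fun this x
  refine term_ext fun v s => ?_
  have hterm (i : Fin (p+1)) : ((-1 : ℤ) ^ (i : ℕ)) •
      (wedge A M (p+1) (Matrix.vecCons (v i) (v ∘ i.succAbove)) ⊗ₜ[A] s) =
        wedge A M (p+1) v ⊗ₜ[A] s := by
    have h := AlternatingMap.neg_one_pow_smul_map_insertNth
      (exteriorPower.ιMulti A (p+1) (M := M)) i (v i) (v ∘ i.succAbove)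
    have hv : i.insertNth (v i) (v ∘ i.succAbove) = v := Fin.insertNth_self_removeNth i v
    rw [hv] at h
    change _ = wedge A M (p+1) (Matrix.vecCons (v i) (v ∘ i.succAbove)) at h
    change ((-1 : ℤ) ^ (i : ℕ)) • wedge A M (p+1) v = _ at h
    rw [← h, TensorProduct.smul_tmul', smul_smul, ← pow_add, Even.neg_one_pow ⟨_, rfl⟩, one_smul]
  simp only [LinearMap.comp_apply, hδ p, map_sum, map_zsmul, ← symMul_tmul,
    homotopy_symMul_zero, extMul_tmul, wedgeLeft_wedge, hterm]
  simp [← Nat.cast_smul_eq_nsmul A]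

theorem apply_homotopy_ext_zero (hδ : IsDifferential A M δ) (q : ℕ) (x : Term A M 0 (q+1)) :
    δ 0 q (homotopy A M 0 q x) = (q + 1 : A) • x := by
  suffices δ 0 q ∘ₗ homotopy A M 0 q = (q + 1 : A) • LinearMap.id from
    LinearMap.congr_fun this x
  clear x
  induction q with
  | zero =>
    refine term_sym_succ_ext fun m x => ?_
    simp [homotopy_symMul_zero, hδ.apply_extMul_zero]
  | succ q ih =>
    refine term_sym_succ_ext fun m x => ?_
    have hx := LinearMap.congr_fun ih x
    simp only [LinearMap.comp_apply, LinearMap.smul_apply, LinearMap.id_apply] at hx ⊢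
    rw [homotopy_symMul_succ, map_add, hδ.apply_extMul_zero, hδ.apply_symMul, hx, map_smul]
    push_cast
    module

theorem apply_homotopy_add_homotopy_apply (hδ : IsDifferential A M δ) (p q : ℕ)
    (x : Term A M (p+1) (q+1)) :
    δ (p+1) q (homotopy A M (p+1) q x) + homotopy A M p (q+1) (δ p (q+1) x) =
      (p + q + 2 : A) • x := by
  suffices δ (p+1) q ∘ₗ homotopy A M (p+1) q + homotopy A M p (q+1) ∘ₗ δ p (q+1) =
      (p + q + 2 : A) • LinearMap.id from LinearMap.congr_fun this x
  clear x
  induction q with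
  | zero =>
    refine term_sym_succ_ext fun m x => ?_
    simp only [LinearMap.comp_apply, LinearMap.add_apply, LinearMap.smul_apply,
      LinearMap.id_apply]
    rw [homotopy_symMul_zero, hδ.apply_extMul_succ, hδ.apply_symMul, homotopy_symMul_succ,
      hδ.homotopy_apply_sym_zero, map_smul]
    push_cast
    module
  | succ q ih =>
    refine term_sym_succ_ext fun m x => ?_
    have hx := congrArg (symMul A M (p+1) (q+1) m) (LinearMap.congr_fun ih x)
    simp only [LinearMap.comp_apply, LinearMap.add_apply, LinearMap.smul_apply,
      LinearMap.id_apply, map_add, map_smul] at hx ⊢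
    rw [homotopy_symMul_succ, map_add, hδ.apply_extMul_succ, hδ.apply_symMul, hδ.apply_symMul,
      homotopy_symMul_succ, ← sub_eq_zero]
    rw [← sub_eq_zero] at hx
    rw [← hx]
    push_cast
    module

end IsDifferential
end KoszulComplex

/-- if the positive integer `n` is invertible in `A`, the degree-`n`
homogeneous component of the Koszul complex of an `A`-module `M`,
`0 → ⋀ⁿM → ⋀ⁿ⁻¹M ⊗ Sym¹M → ⋯ → ⋀ᵖM ⊗ Symⁿ⁻ᵖM → ⋯ → SymⁿM → 0`,
with differential `(m₁∧⋯∧m_p) ⊗ s ↦ Σᵢ (−1)^{i+1} m₁∧⋯∧m̂ᵢ∧⋯∧m_p ⊗ (mᵢ·s)`,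
is exact. -/
theorem stmt_3 (n : ℕ) (hn : 0 < n) (hu : IsUnit (n : A))
    (δ : ∀ p q : ℕ,
      (⋀[A]^(p+1) M) ⊗[A] (SymPow A M q) →ₗ[A] (⋀[A]^p M) ⊗[A] (SymPow A M (q+1)))
    (hδ : ∀ (p q : ℕ) (m : Fin (p+1) → M) (s : SymPow A M q),
      δ p q ((wedge A M (p+1) m) ⊗ₜ[A] s) =
        ∑ i : Fin (p+1), ((-1 : ℤ) ^ (i : ℕ)) •
          ((wedge A M p (m ∘ i.succAbove)) ⊗ₜ[A] (mulBy A M (m i) q s))) :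
    (∀ p q : ℕ, p + q + 2 = n →
        LinearMap.range (δ (p+1) q) = LinearMap.ker (δ p (q+1))) ∧
    (∀ q : ℕ, q + 1 = n → Function.Surjective (δ 0 q)) ∧
    (∀ p : ℕ, p + 1 = n → Function.Injective (δ p 0)) := by
  have hd : KoszulComplex.IsDifferential A M δ := hδ
  have inv (k : ℕ) (hk : k = n) : ∃ u : A, u * k = 1 := by
    subst hk
    exact hu.exists_left_inv
  refine ⟨fun p q h => ?_, fun q h x => ?_, fun p h => ?_⟩
  · obtain ⟨u, hu⟩ := inv _ h
    refine le_antisymm ?_ fun x hx => ⟨KoszulComplex.homotopy A M (p+1) q (u • x), ?_⟩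
    · rintro _ ⟨x, rfl⟩
      exact hd.apply_apply p q x
    · have hx' := hd.apply_homotopy_add_homotopy_apply p q x
      rw [LinearMap.mem_ker.1 hx, map_zero, add_zero] at hx'
      push_cast at hu
      rw [map_smul, map_smul, hx', smul_smul, hu, one_smul]
  · obtain ⟨u, hu⟩ := inv _ h
    refine ⟨KoszulComplex.homotopy A M 0 q (u • x), ?_⟩
    push_cast at hu
    rw [map_smul, map_smul, hd.apply_homotopy_ext_zero, smul_smul, hu, one_smul]
  · obtain ⟨u, hu⟩ := inv _ h
    refine (injective_iff_map_eq_zero _).2 fun x hx => ?_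
    have hx' := hd.homotopy_apply_sym_zero p x
    rw [hx, map_zero] at hx'
    push_cast at hu
    rw [← one_smul A x, ← hu, mul_smul, ← hx', smul_zero]
end

section
/- Let A be a commutative ring and consider the Koszul complex of the sequence (x_0,…,x_m) over B = A[x_0,…,x_m]: the complex ⋯ → ⋀^p B^{m+1} → ⋀^{p-1} B^{m+1} → ⋯ → B^{m+1} → B with differential the contraction against (x_0,…,x_m). This complex is a free resolution of A = B/(x_0,…,x_m); i.e., its homology vanishes in all negative degrees and equals A in degree 0. -/
noncomputable section

variable (A : Type) [CommRing A] (m : ℕ)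

/-- Wedges of vectors in `B^{m+1}` over `B = A[x_0,…,x_m]`, as elements of the `p`-th
exterior power. -/
def wedgeB (p : ℕ)
    (v : Fin p → (Fin (m+1) → MvPolynomial (Fin (m+1)) A)) :
    ⋀[MvPolynomial (Fin (m+1)) A]^p (Fin (m+1) → MvPolynomial (Fin (m+1)) A) :=
  ⟨ExteriorAlgebra.ιMulti (MvPolynomial (Fin (m+1)) A) p v,
    ExteriorAlgebra.ιMulti_range (MvPolynomial (Fin (m+1)) A) p (Set.mem_range_self v)⟩

section Koszul

open exteriorPower

section General

variable {R M : Type*} [CommRing R] [AddCommGroup M] [Module R M]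

/-- Left multiplication by a vector, as a map of consecutive exterior powers. -/
def wedgeLeft (p : ℕ) (v : M) : ⋀[R]^p M →ₗ[R] ⋀[R]^(p + 1) M :=
  (LinearMap.mulLeft R (ExteriorAlgebra.ι R v)).restrict fun w hw => by
    rw [LinearMap.mulLeft_apply, ExteriorAlgebra.exteriorPower, pow_succ']
    exact Submodule.mul_mem_mul (LinearMap.mem_range_self _ v) hw

theorem wedgeLeft_ιMulti (p : ℕ) (v : M) (u : Fin p → M) :
    wedgeLeft p v (ιMulti R p u) = ιMulti R (p + 1) (Fin.cons v u) := by
  ext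
  simp [wedgeLeft, ExteriorAlgebra.ιMulti_succ_apply, Matrix.vecTail, Function.comp_def]

/-- The family `δ` is the contraction against the linear form `φ`. -/
def IsContraction (φ : M →ₗ[R] R) (δ : ∀ p : ℕ, ⋀[R]^(p + 1) M →ₗ[R] ⋀[R]^p M) : Prop :=
  ∀ (p : ℕ) (v : Fin (p + 1) → M), δ p (ιMulti R (p + 1) v) =
    ∑ i : Fin (p + 1), ((-1 : ℤ) ^ (i : ℕ)) • (φ (v i) • ιMulti R p (v ∘ i.succAbove))

variable {φ : M →ₗ[R] R} {δ : ∀ p : ℕ, ⋀[R]^(p + 1) M →ₗ[R] ⋀[R]^p M}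

theorem IsContraction.wedgeLeft_zero (h : IsContraction φ δ) (v : M) (w : ⋀[R]^0 M) :
    δ 0 (wedgeLeft 0 v w) = φ v • w := by
  suffices δ 0 ∘ₗ wedgeLeft 0 v = φ v • LinearMap.id from LinearMap.congr_fun this w
  refine exteriorPower.linearMap_ext (AlternatingMap.ext fun u => ?_)
  simp [wedgeLeft_ιMulti, h 0, Subsingleton.elim _ u]

theorem IsContraction.wedgeLeft_succ (h : IsContraction φ δ) (p : ℕ) (v : M)
    (w : ⋀[R]^(p + 1) M) :
    δ (p + 1) (wedgeLeft (p + 1) v w) = φ v • w - wedgeLeft p v (δ p w) := by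
  suffices δ (p + 1) ∘ₗ wedgeLeft (p + 1) v = φ v • LinearMap.id - wedgeLeft p v ∘ₗ δ p from
    LinearMap.congr_fun this w
  refine exteriorPower.linearMap_ext (AlternatingMap.ext fun u => ?_)
  have hcons (k : Fin (p + 1)) : (Fin.cons v u : Fin (p + 2) → M) ∘ k.succ.succAbove =
      Fin.cons v (u ∘ k.succAbove) := by
    ext j
    cases j using Fin.cases <;> simp
  have hcons_zero : (Fin.cons v u : Fin (p + 2) → M) ∘ Fin.succ = u := by
    ext j
    simp
  simp [wedgeLeft_ιMulti, h p, h (p + 1), Fin.sum_univ_succ (n := p + 1), hcons, hcons_zero,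
    pow_succ, sub_eq_add_neg]

theorem ιMulti_succ_eq_wedgeLeft (p : ℕ) (u : Fin (p + 1) → M) :
    ιMulti R (p + 1) u = wedgeLeft p (u 0) (ιMulti R p (Fin.tail u)) := by
  rw [wedgeLeft_ιMulti, Fin.cons_self_tail]

theorem IsContraction.comp_eq_zero (h : IsContraction φ δ) (p : ℕ) :
    δ p ∘ₗ δ (p + 1) = 0 := by
  induction p with
  | zero =>
    refine exteriorPower.linearMap_ext (AlternatingMap.ext fun u => ?_)
    simp [ιMulti_succ_eq_wedgeLeft, h.wedgeLeft_succ, h.wedgeLeft_zero, smul_comm (φ (u 0))]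
  | succ p ih =>
    refine exteriorPower.linearMap_ext (AlternatingMap.ext fun u => ?_)
    have := LinearMap.congr_fun ih (ιMulti R (p + 2) (Fin.tail u))
    simp only [LinearMap.comp_apply, LinearMap.zero_apply] at this
    simp [ιMulti_succ_eq_wedgeLeft (p + 2) u, h.wedgeLeft_succ, this]

theorem wedgeLeft_ιMulti_succAbove (p : ℕ) (u : Fin (p + 1) → M) (k : Fin (p + 1)) :
    ((-1 : ℤ) ^ (k : ℕ)) • wedgeLeft p (u k) (ιMulti R p (u ∘ k.succAbove)) =
      ιMulti R (p + 1) u := by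
  have hperm : (Fin.cons (u k) (u ∘ k.succAbove) : Fin (p + 1) → M) = u ∘ k.cycleRange.symm :=
    Fin.cons_removeNth_eq_comp_cycleRange_symm u k
  rw [wedgeLeft_ιMulti, hperm, AlternatingMap.map_perm, Equiv.Perm.sign_symm,
    Fin.sign_cycleRange, Units.smul_def, smul_smul]
  simp [← mul_pow]

/-- Apply an additive endomorphism of the scalars to every coordinate in a basis. -/
def coordMap {I : Type*} (b : Module.Basis I R M) (T : R →+ R) : M →+ M :=
  b.repr.symm.toAddMonoidHom.comp
    ((Finsupp.mapRange.addMonoidHom T).comp b.repr.toAddMonoidHom)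

theorem repr_coordMap {I : Type*} (b : Module.Basis I R M) (T : R →+ R) (w : M) (s : I) :
    b.repr (coordMap b T w) s = T (b.repr w s) := by
  simp [coordMap]

theorem coordMap_smul {I : Type*} (b : Module.Basis I R M) (T : R →+ R) {w : M}
    (hw : ∀ s, ∃ z : ℤ, b.repr w s = z) (c : R) :
    coordMap b T (c • w) = T c • w := by
  refine b.repr.injective (Finsupp.ext fun s => ?_)
  obtain ⟨z, hz⟩ := hw s
  rw [repr_coordMap, map_smul, map_smul, Finsupp.smul_apply, Finsupp.smul_apply, hz, smul_eq_mul,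
    smul_eq_mul, mul_comm, ← zsmul_eq_mul, map_zsmul, zsmul_eq_mul, mul_comm]

end General

section Polynomial

open MvPolynomial

variable {S σ : Type*} [CommRing S]

/-- Division of polynomials by the variable `X i`, discarding the remainder. -/
def divX (i : σ) : MvPolynomial σ S →+ MvPolynomial σ S where
  toFun c := c.divMonomial (Finsupp.single i 1)
  map_zero' := zero_divMonomial _
  map_add' _ _ := add_divMonomial _ _ _

theorem divX_mul_X (i : σ) (c : MvPolynomial σ S) : divX i (c * X i) = c :=
  mul_X_divMonomial c i

theorem divX_mul_X_of_ne {i j : σ} (hij : j ≠ i) (c : MvPolynomial σ S) :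
    divX i (c * X j) = divX i c * X j := by
  classical
  ext d
  have hmem : j ∈ (Finsupp.single i 1 + d).support ↔ j ∈ d.support := by
    simp [Finsupp.single_eq_of_ne hij]
  simp only [divX, AddMonoidHom.coe_mk, ZeroHom.coe_mk, coeff_divMonomial, coeff_mul_X', hmem]
  split_ifs with hj
  · congr 1
    ext k
    by_cases hk : k = j
    · subst hk
      simp [Finsupp.single_eq_of_ne hij]
    · simp [Finsupp.single_eq_of_ne hk]
  · rfl

theorem mem_idealOfVars_iff_constantCoeff_eq_zero (c : MvPolynomial σ S) :
    c ∈ idealOfVars σ S ↔ constantCoeff c = 0 := by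
  rw [← pow_one (idealOfVars σ S), mem_pow_idealOfVars_iff', constantCoeff_eq]
  refine ⟨fun h => h 0 (by simp), fun h d hd => ?_⟩
  rw [(Finsupp.degree_eq_zero_iff d).1 (Nat.lt_one_iff.1 hd), h]

variable [LinearOrder σ] [Fintype σ]

/-- The basis of the exterior power of `B^σ` given by wedges of the standard vectors. -/
abbrev stdBasis (S σ : Type*) [CommRing S] [LinearOrder σ] [Fintype σ] (p : ℕ) :=
  (Pi.basisFun (MvPolynomial σ S) σ).exteriorPower p

/-- The wedge of the standard vectors indexed by the entries of `f`. -/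
abbrev stdWedge (S : Type*) {σ : Type*} [CommRing S] [LinearOrder σ] {p : ℕ}
    (f : Fin p → σ) : ⋀[MvPolynomial σ S]^p (σ → MvPolynomial σ S) :=
  ιMulti (MvPolynomial σ S) p fun k => Pi.single (f k) 1

theorem stdBasis_apply {p : ℕ} (s : Set.powersetCard σ p) :
    stdBasis S σ p s = stdWedge S (Set.powersetCard.ofFinEmbEquiv.symm s) := by
  rw [basis_apply, ιMulti_family]
  congr 1
  ext k
  simp

theorem exists_int_repr_stdWedge {p : ℕ} (f : Fin p → σ) (s : Set.powersetCard σ p) :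
    ∃ z : ℤ, (stdBasis S σ p).repr (stdWedge S f) s = z := by
  refine ⟨(Matrix.of fun i j : Fin p =>
    if Set.powersetCard.ofFinEmbEquiv.symm s j = f i then (1 : ℤ) else 0).det, ?_⟩
  rw [basis_repr_apply, ιMultiDual_apply_ιMulti, Int.cast_det]
  congr 1
  ext1 i j
  simp [Pi.single_apply]

/-- Divide the coefficients by `X i`, then wedge with the `i`-th standard vector. -/
def wedgeDivX (S : Type*) {σ : Type*} [CommRing S] [LinearOrder σ] [Fintype σ] (i : σ) (p : ℕ) :
    ⋀[MvPolynomial σ S]^p (σ → MvPolynomial σ S) →+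
      ⋀[MvPolynomial σ S]^(p + 1) (σ → MvPolynomial σ S) :=
  (wedgeLeft p (Pi.single i 1)).toAddMonoidHom.comp (coordMap (stdBasis S σ p) (divX i))

theorem wedgeDivX_smul_stdWedge (i : σ) {p : ℕ} (c : MvPolynomial σ S) (f : Fin p → σ) :
    wedgeDivX S i p (c • stdWedge S f) = divX i c • wedgeLeft p (Pi.single i 1) (stdWedge S f) := by
  simp [wedgeDivX, coordMap_smul _ _ (exists_int_repr_stdWedge f)]

variable {φ : (σ → MvPolynomial σ S) →ₗ[MvPolynomial σ S] MvPolynomial σ S}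
  {δ : ∀ p : ℕ, ⋀[MvPolynomial σ S]^(p + 1) (σ → MvPolynomial σ S) →ₗ[MvPolynomial σ S]
    ⋀[MvPolynomial σ S]^p (σ → MvPolynomial σ S)}

theorem IsContraction.homotopy_smul_stdWedge (h : IsContraction φ δ)
    (hφ : ∀ j, φ (Pi.single j 1) = X j) (i : σ) {p : ℕ} (c : MvPolynomial σ S)
    {f : Fin (p + 1) → σ} (hf : Function.Injective f) [Decidable (i ∈ Set.range f)] :
    c • stdWedge S f - (δ (p + 1) (wedgeDivX S i (p + 1) (c • stdWedge S f)) +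
      wedgeDivX S i p (δ p (c • stdWedge S f))) =
    if i ∈ Set.range f then 0 else (c - X i * divX i c) • stdWedge S f := by
  have hδ : δ p (stdWedge S f) =
      ∑ k : Fin (p + 1), ((-1 : ℤ) ^ (k : ℕ)) •
        ((X (f k) : MvPolynomial σ S) • stdWedge S (f ∘ k.succAbove)) := by
    rw [stdWedge, h p]
    simp only [hφ, Function.comp_def]
  have hsum : c • stdWedge S f - (δ (p + 1) (wedgeDivX S i (p + 1) (c • stdWedge S f)) +
      wedgeDivX S i p (δ p (c • stdWedge S f))) =
      (c - X i * divX i c) • stdWedge S f - ∑ k : Fin (p + 1),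
        (divX i (c * X (f k)) - divX i c * X (f k)) • ((-1 : ℤ) ^ (k : ℕ)) •
          wedgeLeft p (Pi.single i 1) (stdWedge S (f ∘ k.succAbove)) := by
    have hs : wedgeDivX S i p (δ p (c • stdWedge S f)) = ∑ k : Fin (p + 1),
        divX i (c * X (f k)) • ((-1 : ℤ) ^ (k : ℕ)) •
          wedgeLeft p (Pi.single i 1) (stdWedge S (f ∘ k.succAbove)) := by
      rw [map_smul, hδ, Finset.smul_sum, map_sum]
      refine Finset.sum_congr rfl fun k _ => ?_
      rw [smul_comm c, map_zsmul, smul_smul, wedgeDivX_smul_stdWedge, smul_comm]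
    rw [hs, wedgeDivX_smul_stdWedge, map_smul, h.wedgeLeft_succ, hφ, hδ, map_sum, smul_sub,
      Finset.smul_sum]
    have hsub {q : ℕ} (a b : MvPolynomial σ S)
        (w : ⋀[MvPolynomial σ S]^q (σ → MvPolynomial σ S)) : (a - b) • w = a • w - b • w :=
      sub_smul a b w
    simp only [hsub, Finset.sum_sub_distrib]
    simp only [map_zsmul, map_smul, smul_smul, smul_comm _ ((-1 : ℤ) ^ _), mul_comm (X i)]
    abel
  rw [hsum]
  split_ifs with hi
  · obtain ⟨k, rfl⟩ := hi
    have hk : ((-1 : ℤ) ^ (k : ℕ)) • wedgeLeft p (Pi.single (f k) 1)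
        (stdWedge S (f ∘ k.succAbove)) = stdWedge S f :=
      wedgeLeft_ιMulti_succAbove p (fun k => (Pi.single (f k) 1 : σ → MvPolynomial σ S)) k
    rw [Finset.sum_eq_single k, hk, divX_mul_X, mul_comm, sub_self]
    · intro j _ hj
      rw [divX_mul_X_of_ne (hf.ne hj), sub_self, zero_smul]
    · simp
  · rw [Finset.sum_eq_zero, sub_zero]
    intro k _
    rw [divX_mul_X_of_ne fun hk => hi ⟨k, hk⟩, sub_self, zero_smul]

theorem IsContraction.repr_homotopy (h : IsContraction φ δ)
    (hφ : ∀ j, φ (Pi.single j 1) = X j) (i : σ) {p : ℕ}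
    (w : ⋀[MvPolynomial σ S]^(p + 1) (σ → MvPolynomial σ S)) (s : Set.powersetCard σ (p + 1)) :
    (stdBasis S σ (p + 1)).repr
      (w - (δ (p + 1) (wedgeDivX S i (p + 1) w) + wedgeDivX S i p (δ p w))) s =
    if i ∈ (s : Finset σ) then 0 else
      (stdBasis S σ (p + 1)).repr w s - X i * divX i ((stdBasis S σ (p + 1)).repr w s) := by
  classical
  rw [← (stdBasis S σ (p + 1)).sum_repr w]
  generalize ((stdBasis S σ (p + 1)).repr w : Set.powersetCard σ (p + 1) → _) = c
  induction (Finset.univ : Finset (Set.powersetCard σ (p + 1))) using Finset.induction_on with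
  | empty => simp
  | insert t K ht ih =>
    rw [Finset.sum_insert ht]
    generalize ∑ x ∈ K, c x • stdBasis S σ (p + 1) x = w at ih ⊢
    have key := h.homotopy_smul_stdWedge hφ i (c t)
      (f := Set.powersetCard.ofFinEmbEquiv.symm t) (RelEmbedding.injective _)
    rw [← stdBasis_apply] at key
    have hsplit : ∀ u v : ⋀[MvPolynomial σ S]^(p + 1) (σ → MvPolynomial σ S),
        (u + v) - (δ (p + 1) (wedgeDivX S i (p + 1) (u + v)) + wedgeDivX S i p (δ p (u + v))) =
        (u - (δ (p + 1) (wedgeDivX S i (p + 1) u) + wedgeDivX S i p (δ p u))) +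
        (v - (δ (p + 1) (wedgeDivX S i (p + 1) v) + wedgeDivX S i p (δ p v))) := by
      intro u v
      simp only [map_add]
      abel
    rw [hsplit, map_add, Finsupp.add_apply, ih, key, map_add, Finsupp.add_apply, map_smul,
      Finsupp.smul_apply, Module.Basis.repr_self, map_add]
    simp only [Set.powersetCard.mem_range_ofFinEmbEquiv_symm_iff_mem, ← Set.powersetCard.mem_coe_iff]
    by_cases hst : t = s
    · subst hst
      split_ifs
      · simp
      · simp
        ring
    · split_ifs <;> simp [basis_repr_ne _ _ _ hst, Finsupp.single_eq_of_ne (Ne.symm hst)]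

theorem IsContraction.ker_eq_range (h : IsContraction φ δ)
    (hφ : ∀ j, φ (Pi.single j 1) = X j) (p : ℕ) :
    LinearMap.ker (δ p) = LinearMap.range (δ (p + 1)) := by
  classical
  refine le_antisymm (fun w hw => ?_) (LinearMap.range_le_ker_iff.2 (h.comp_eq_zero p))
  have hker (u) : δ p (w - δ (p + 1) u) = 0 := by
    rw [map_sub, LinearMap.mem_ker.1 hw, ← LinearMap.comp_apply, h.comp_eq_zero]
    simp
  have key (K : Finset σ) : ∃ u, ∀ s : Set.powersetCard σ (p + 1), (∃ i ∈ K, i ∈ (s : Finset σ)) →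
      (stdBasis S σ (p + 1)).repr (w - δ (p + 1) u) s = 0 := by
    induction K using Finset.induction_on with
    | empty => exact ⟨0, by simp⟩
    | insert i K hi ih =>
      obtain ⟨u, hu⟩ := ih
      refine ⟨u + wedgeDivX S i (p + 1) (w - δ (p + 1) u), fun s hs => ?_⟩
      have hrepr := h.repr_homotopy hφ i (w - δ (p + 1) u) s
      rw [hker, map_zero, add_zero, sub_sub, ← map_add] at hrepr
      rw [hrepr]
      split_ifs with his
      · rfl
      · obtain ⟨j, hj, hjs⟩ := hs
        have hjK : j ∈ K := (Finset.mem_insert.1 hj).resolve_left fun hji => his (hji ▸ hjs)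
        rw [hu s ⟨j, hjK, hjs⟩, map_zero, mul_zero, sub_zero]
  obtain ⟨u, hu⟩ := key Finset.univ
  refine ⟨u, (sub_eq_zero.1 ((stdBasis S σ (p + 1)).repr.injective ?_)).symm⟩
  rw [map_zero]
  ext1 s
  refine hu s ?_
  obtain ⟨i, hi⟩ : (s : Finset σ).Nonempty := Finset.card_pos.1 (by
    rw [show (s : Finset σ).card = p + 1 from s.2]; omega)
  exact ⟨i, Finset.mem_univ i, hi⟩

theorem IsContraction.mem_range_zero_iff (h : IsContraction φ δ)
    (hφ : ∀ j, φ (Pi.single j 1) = X j)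
    (w : ⋀[MvPolynomial σ S]^0 (σ → MvPolynomial σ S)) :
    w ∈ LinearMap.range (δ 0) ↔
      constantCoeff (zeroEquiv (MvPolynomial σ S) (σ → MvPolynomial σ S) w) = 0 := by
  let e := zeroEquiv (MvPolynomial σ S) (σ → MvPolynomial σ S)
  have hφ_mem (v : σ → MvPolynomial σ S) : φ v ∈ idealOfVars σ S := by
    rw [← (Pi.basisFun (MvPolynomial σ S) σ).sum_repr v, map_sum]
    refine Ideal.sum_mem _ fun j _ => ?_
    rw [map_smul, Pi.basisFun_apply, hφ]
    exact Ideal.mul_mem_left _ _ (Ideal.subset_span ⟨j, rfl⟩)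
  have hrange : LinearMap.range (e.toLinearMap ∘ₗ δ 0) = idealOfVars σ S := by
    refine le_antisymm ?_ (Ideal.span_le.2 ?_)
    · rw [LinearMap.range_eq_map, ← ιMulti_span, Submodule.map_span_le]
      rintro _ ⟨v, rfl⟩
      rw [LinearMap.comp_apply, ιMulti_succ_eq_wedgeLeft, h.wedgeLeft_zero, map_smul]
      exact Ideal.mul_mem_right _ _ (hφ_mem _)
    · rintro _ ⟨j, rfl⟩
      refine ⟨wedgeLeft 0 (Pi.single j 1) (e.symm 1), ?_⟩
      rw [LinearMap.comp_apply, h.wedgeLeft_zero, hφ, map_smul]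
      simp
  rw [← mem_idealOfVars_iff_constantCoeff_eq_zero, ← hrange, LinearMap.range_comp]
  exact (e.injective.mem_set_image (s := (LinearMap.range (δ 0) : Set _))).symm

end Polynomial

end Koszul

/-- the Koszul complex of the sequence `(x_0,…,x_m)` over
`B = A[x_0,…,x_m]`, `⋯ → ⋀^p B^{m+1} → ⋯ → B^{m+1} → B`, with differential the
contraction against `(x_0,…,x_m)`, is a free resolution of `A = B/(x_0,…,x_m)`:
its homology vanishes in all negative degrees and equals `A` in degree `0`. -/
theorem stmt_10
    (δ : ∀ p : ℕ,
      (⋀[MvPolynomial (Fin (m+1)) A]^(p+1) (Fin (m+1) → MvPolynomial (Fin (m+1)) A))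
        →ₗ[MvPolynomial (Fin (m+1)) A]
      (⋀[MvPolynomial (Fin (m+1)) A]^p (Fin (m+1) → MvPolynomial (Fin (m+1)) A)))
    (hδ : ∀ (p : ℕ) (v : Fin (p+1) → (Fin (m+1) → MvPolynomial (Fin (m+1)) A)),
      δ p (wedgeB A m (p+1) v) =
        ∑ i : Fin (p+1), ((-1 : ℤ) ^ (i : ℕ)) •
          ((∑ j : Fin (m+1), MvPolynomial.X j * v i j) • wedgeB A m p (v ∘ i.succAbove))) :
    (∀ p : ℕ, LinearMap.ker (δ p) = LinearMap.range (δ (p+1))) ∧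
    Nonempty
      (((⋀[MvPolynomial (Fin (m+1)) A]^0 (Fin (m+1) → MvPolynomial (Fin (m+1)) A)) ⧸
          LinearMap.range (δ 0)) ≃ₗ[A] A) := by
  have h : IsContraction (∑ j : Fin (m+1), MvPolynomial.X (R := A) j • LinearMap.proj j) δ := by
    intro p v
    simp only [LinearMap.sum_apply, LinearMap.smul_apply, LinearMap.proj_apply, smul_eq_mul]
    exact hδ p v
  have hφ (j : Fin (m+1)) : (∑ j : Fin (m+1), MvPolynomial.X (R := A) j •
      LinearMap.proj (R := MvPolynomial (Fin (m+1)) A) j) (Pi.single j 1) =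
        (MvPolynomial.X j : MvPolynomial (Fin (m+1)) A) := by
    simp [LinearMap.sum_apply, Pi.single_apply]
  refine ⟨h.ker_eq_range hφ, ?_⟩
  let g : (⋀[MvPolynomial (Fin (m+1)) A]^0 (Fin (m+1) → MvPolynomial (Fin (m+1)) A)) →ₗ[A] A :=
    (MvPolynomial.aeval (0 : Fin (m+1) → A)).toLinearMap ∘ₗ
      (exteriorPower.zeroEquiv _ _).toLinearMap.restrictScalars A
  have hg (w) : g w = MvPolynomial.constantCoeff (exteriorPower.zeroEquiv _ _ w) := by
    simp [g]
  have hsurj : Function.Surjective g := fun a =>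
    ⟨(exteriorPower.zeroEquiv _ _).symm (MvPolynomial.C a), by simp [hg]⟩
  have hker : (LinearMap.range (δ 0)).restrictScalars A = LinearMap.ker g := by
    ext w
    rw [Submodule.restrictScalars_mem, h.mem_range_zero_iff hφ, LinearMap.mem_ker, hg]
  exact ⟨(Submodule.Quotient.restrictScalarsEquiv A _).symm.trans
    ((Submodule.quotEquivOfEq _ _ hker).trans (g.quotKerEquivOfSurjective hsurj))⟩

end
end

section
/- Over a commutative ring A, the local cohomology of the affine space at the origin satisfies: for B = A[x_1,…,x_m] and I = (x_1,…,x_m), H^i_I(B) = 0 for i ≠ m, and H^m_I(B) ≅ (1/(x_1⋯x_m))·A[1/x_1,…,1/x_m], the A-submodule of the localization B[1/(x_1⋯x_m)] spanned by monomials x_1^{−a_1}⋯x_m^{−a_m} with all a_i ≥ 1. -/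
noncomputable section

open MvPolynomial

section

open CategoryTheory Limits

universe w v u

namespace HomologicalComplex

lemma homologyUnop_hom_naturality {ι V : Type*} [Category V]
    {c : ComplexShape ι} [HasZeroMorphisms V]
    {K L : HomologicalComplex Vᵒᵖ c} (φ : K ⟶ L) (i : ι) [K.HasHomology i] [L.HasHomology i] :
    homologyMap ((unopFunctor _ _).map φ.op) i ≫ (K.homologyUnop i).hom =
      (L.homologyUnop i).hom ≫ (homologyMap φ i).unop :=
  Quiver.Hom.op_inj (homologyOp_hom_naturality ((unopFunctor _ _).map φ.op) i).symm

end HomologicalComplex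

namespace CategoryTheory.ProjectiveResolution

open Abelian CochainComplex HomComplex

section

variable {C : Type u} [Category.{v} C] [Abelian C] [HasExt.{w} C] {X Y : C}
  (P : ProjectiveResolution X)

lemma extMk_zero_degree_eq_zero_iff (f : P.complex.X 0 ⟶ Y) (m : ℕ) (hm : 0 + 1 = m)
    (hf : P.complex.d m 0 ≫ f = 0) : P.extMk f m hm hf = 0 ↔ f = 0 := by
  simp only [← P.extEquivCohomologyClass.apply_eq_iff_eq,
    extEquivCohomologyClass_extMk, extEquivCohomologyClass_zero,
    CohomologyClass.mk_eq_zero_iff]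
  rw [Cocycle.toSingleMk_mem_coboundaries_iff _ _ _ _ _ 1 (by lia)]
  have h0 : P.cochainComplex.d ((-(0 : ℕ) : ℤ)) 1 = 0 :=
    (CochainComplex.isZero_of_isStrictlyLE P.cochainComplex 0 1).eq_of_tgt _ _
  simp only [h0, zero_comp, exists_const]
  rw [eq_comm, Preadditive.IsIso.comp_left_eq_zero]

end

section

variable {R : Type*} [CommRing R] {C : Type u} [Category.{v} C] [Abelian C] [Linear R C]
  {X : C} {P : ProjectiveResolution X} (Y : C) (n : ℕ)

/-- The map of complexes of morphisms to `Y` induced by a map of projective resolutions. -/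
def linearYonedaObjMap {X' : C} {P' : ProjectiveResolution X'}
    (φ : P'.complex ⟶ P.complex) :
    P.complex.linearYonedaObj R Y ⟶ P'.complex.linearYonedaObj R Y :=
  (HomologicalComplex.unopFunctor _ _).map
    ((((linearYoneda R C).obj Y).rightOp.mapHomologicalComplex _).map φ).op

lemma comp_trans_symm_hom_eq {D : Type*} [Category D] {X₁ X₂ Y₁ Y₂ Z₁ Z₂ : D}
    {a : X₁ ⟶ X₂} {b : Y₁ ⟶ Y₂} {c : Z₁ ⟶ Z₂} (u₁ : X₁ ≅ Y₁) (u₂ : X₂ ≅ Y₂)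
    {v₁ : Z₁ ≅ Y₁} {v₂ : Z₂ ≅ Y₂}
    (h : a ≫ u₂.hom = u₁.hom ≫ b) (h' : c ≫ v₂.hom = v₁.hom ≫ b) :
    a ≫ (u₂ ≪≫ v₂.symm).hom = (u₁ ≪≫ v₁.symm).hom ≫ c := by
  simp [← cancel_mono v₂.hom, h, h']

lemma isoExt_hom_naturality [EnoughProjectives C] {X' : C} {P' : ProjectiveResolution X'}
    (g : X' ⟶ X) (φ : Hom P' P g) :
    ((_root_.Ext R C n).map g.op).app Y ≫ (P'.isoExt n Y).hom =
    (P.isoExt n Y).hom ≫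
      HomologicalComplex.homologyMap (linearYonedaObjMap (R := R) Y φ.hom) n := by
  have h1 := congrArg Quiver.Hom.unop (isoLeftDerivedObj_inv_naturality g P' P φ.hom
    (φ.hom_f_zero_comp_π_f_zero.trans (by rw [ChainComplex.single₀_map_f_zero]; rfl))
    ((linearYoneda R C).obj Y).rightOp n)
  have h2 := HomologicalComplex.homologyUnop_hom_naturality
    ((((linearYoneda R C).obj Y).rightOp.mapHomologicalComplex _).map φ.hom) n
  exact comp_trans_symm_hom_eq
    ((P.isoLeftDerivedObj ((linearYoneda R C).obj Y).rightOp n).unop.symm)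
    ((P'.isoLeftDerivedObj ((linearYoneda R C).obj Y).rightOp n).unop.symm) h1 h2

end

variable {R : Type*} [CommRing R] {C : Type u} [Category.{v} C] [Abelian C] [HasExt.{v} C]
  [Linear R C] {X : C} (P : ProjectiveResolution X) (Y : C) (n : ℕ)

lemma smul_extMk {n : ℕ} (r : R) {Y : C} (f : P.complex.X n ⟶ Y) (m : ℕ) (hm : n + 1 = m)
    (hf : P.complex.d m n ≫ f = 0) :
    r • P.extMk f m hm hf = P.extMk (r • f) m hm (by simp [hf]) := by
  rw [Ext.smul_eq_comp_mk₀, extMk_comp_mk₀]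
  simp

/-- The class in `Ext X Y n` of a cocycle on a projective resolution of `X`. -/
def cocyclesToExt :
    LinearMap.ker ((P.complex.linearYonedaObj R Y).sc n).g.hom →ₗ[R] Ext X Y n where
  toFun f := P.extMk (f.1 : P.complex.X n ⟶ Y) ((ComplexShape.up ℕ).next n) (by simp) f.2
  map_add' f g := (P.add_extMk _ _ _ _ _ _).symm
  map_smul' r f := (P.smul_extMk r _ _ _ _).symm

lemma cocyclesToExt_surjective : Function.Surjective (P.cocyclesToExt (R := R) Y n) := fun x ↦ by
  obtain ⟨f, hf, rfl⟩ := P.extMk_surjective x ((ComplexShape.up ℕ).next n) (by simp)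
  exact ⟨⟨f, hf⟩, rfl⟩

lemma ker_cocyclesToExt : LinearMap.ker (P.cocyclesToExt (R := R) Y n) =
    LinearMap.range ((P.complex.linearYonedaObj R Y).sc n).moduleCatToCycles := by
  ext ⟨f, hf⟩
  obtain _ | n := n
  · refine (P.extMk_zero_degree_eq_zero_iff (Y := Y) f _ (by simp) hf).trans ?_
    have h0 : ((P.complex.linearYonedaObj R Y).sc 0).f = 0 :=
      (P.complex.linearYonedaObj R Y).shape ((ComplexShape.up ℕ).prev 0) 0 (Nat.succ_ne_zero _)
    constructor
    · rintro rfl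
      exact zero_mem _
    · rintro ⟨g, hg⟩
      exact (congrArg Subtype.val hg).symm.trans (congrArg (fun t ↦ t.hom g) h0)
  · refine (P.extMk_eq_zero_iff (Y := Y) f _ (by simp) hf
      ((ComplexShape.up ℕ).prev (n + 1)) (by simp)).trans ?_
    constructor
    · rintro ⟨g, hg⟩
      exact ⟨g, Subtype.ext hg⟩
    · rintro ⟨g, hg⟩
      exact ⟨g, congrArg Subtype.val hg⟩

/-- `Ext X Y n` is the cohomology of the complex of morphisms from a projective resolution. -/
def homologyLinearEquivExt :
    (P.complex.linearYonedaObj R Y).homology n ≃ₗ[R] Ext X Y n :=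
  ((P.complex.linearYonedaObj R Y).sc n).moduleCatHomologyIso.toLinearEquiv ≪≫ₗ
    Submodule.quotEquivOfEq _ _ (P.ker_cocyclesToExt Y n).symm ≪≫ₗ
    (P.cocyclesToExt Y n).quotKerEquivOfSurjective (P.cocyclesToExt_surjective Y n)

lemma homologyLinearEquivExt_π (z : (P.complex.linearYonedaObj R Y).cycles n) :
    P.homologyLinearEquivExt Y n ((P.complex.linearYonedaObj R Y).homologyπ n z) =
    P.cocyclesToExt Y n
      (((P.complex.linearYonedaObj R Y).sc n).moduleCatCyclesIso.hom z) := by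
  have := congrArg (fun t ↦ t.hom z)
    ((P.complex.linearYonedaObj R Y).sc n).π_moduleCatCyclesIso_hom
  simp only [homologyLinearEquivExt, LinearEquiv.trans_apply]
  refine (congrArg (fun t ↦
    ((P.cocyclesToExt Y n).quotKerEquivOfSurjective (P.cocyclesToExt_surjective Y n))
      (Submodule.quotEquivOfEq _ _ (P.ker_cocyclesToExt Y n).symm t)) this).trans ?_
  rfl

variable {P}

lemma cocyclesToExt_naturality {X' : C} {P' : ProjectiveResolution X'} (g : X' ⟶ X)
    (φ : Hom P' P g) (z : LinearMap.ker ((P.complex.linearYonedaObj R Y).sc n).g.hom)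
    (z' : LinearMap.ker ((P'.complex.linearYonedaObj R Y).sc n).g.hom)
    (h : (z'.1 : P'.complex.X n ⟶ Y) = φ.hom.f n ≫ z.1) :
    P'.cocyclesToExt Y n z' = (Ext.mk₀ g).comp (P.cocyclesToExt Y n z) (zero_add _) := by
  obtain ⟨f, hf⟩ := z
  obtain ⟨f', hf'⟩ := z'
  subst h
  exact (P.mk₀_comp_extMk (Y := Y) f _ (by simp) hf φ).symm

lemma homologyLinearEquivExt_naturality {X' : C} {P' : ProjectiveResolution X'} (g : X' ⟶ X)
    (φ : Hom P' P g) (x) :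
    P'.homologyLinearEquivExt Y n
      (HomologicalComplex.homologyMap (linearYonedaObjMap (R := R) Y φ.hom) n x) =
    (Ext.mk₀ g).comp (P.homologyLinearEquivExt Y n x) (zero_add _) := by
  obtain ⟨z, rfl⟩ : ∃ z, (P.complex.linearYonedaObj R Y).homologyπ n z = x :=
    (ModuleCat.epi_iff_surjective _).1 inferInstance x
  have h := congrArg (fun t ↦ t.hom z)
    (HomologicalComplex.homologyπ_naturality (linearYonedaObjMap (R := R) Y φ.hom) n)
  simp only [ModuleCat.hom_comp, LinearMap.comp_apply] at h
  rw [h, homologyLinearEquivExt_π, homologyLinearEquivExt_π]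
  have h1 : (((P'.complex.linearYonedaObj R Y).sc n).moduleCatCyclesIso.hom
      (HomologicalComplex.cyclesMap (linearYonedaObjMap (R := R) Y φ.hom) n z)).1 =
        φ.hom.f n ≫ (((P.complex.linearYonedaObj R Y).sc n).moduleCatCyclesIso.hom z).1 := by
    have e1 := congrArg
      (fun t ↦ t.hom (HomologicalComplex.cyclesMap (linearYonedaObjMap (R := R) Y φ.hom) n z))
      ((P'.complex.linearYonedaObj R Y).sc n).moduleCatCyclesIso_hom_i
    have e2 := congrArg (fun t ↦ t.hom z)
      ((P.complex.linearYonedaObj R Y).sc n).moduleCatCyclesIso_hom_i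
    have e3 := congrArg (fun t ↦ t.hom z)
      (HomologicalComplex.cyclesMap_i (linearYonedaObjMap (R := R) Y φ.hom) n)
    refine e1.trans (e3.trans ?_)
    exact congrArg (fun t ↦ φ.hom.f n ≫ t) e2.symm
  exact cocyclesToExt_naturality Y n g φ _ _ h1

/-- The derived-functor `Ext` agrees with the `Ext` of the derived category. -/
def extLinearEquiv [EnoughProjectives C] (P : ProjectiveResolution X) :
    ((_root_.Ext R C n).obj (Opposite.op X)).obj Y ≃ₗ[R] Ext X Y n :=
  (P.isoExt n Y).toLinearEquiv ≪≫ₗ P.homologyLinearEquivExt Y n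

lemma extLinearEquiv_naturality [EnoughProjectives C] {X' : C} {P' : ProjectiveResolution X'}
    (g : X' ⟶ X) (φ : Hom P' P g) (x : ((_root_.Ext R C n).obj (Opposite.op X)).obj Y) :
    P'.extLinearEquiv Y n (((_root_.Ext R C n).map g.op).app Y x) =
      (Ext.mk₀ g).comp (P.extLinearEquiv Y n x) (zero_add _) := by
  refine Eq.trans ?_ (homologyLinearEquivExt_naturality (R := R) Y n g φ ((P.isoExt n Y).hom x))
  exact congrArg (fun t ↦ P'.homologyLinearEquivExt Y n (t.hom x))
    (isoExt_hom_naturality (R := R) Y n g φ)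

variable (R) in
theorem _root_.CategoryTheory.exists_ext_linearEquiv [EnoughProjectives C] :
    ∃ e : ∀ X : C, ((_root_.Ext R C n).obj (Opposite.op X)).obj Y ≃ₗ[R] Ext X Y n,
      ∀ ⦃X' X : C⦄ (g : X' ⟶ X) (x : ((_root_.Ext R C n).obj (Opposite.op X)).obj Y),
        e X' (((_root_.Ext R C n).map g.op).app Y x) =
          (Ext.mk₀ g).comp (e X x) (zero_add _) := by
  refine ⟨fun X ↦ (projectiveResolution X).extLinearEquiv Y n, fun X' X g x ↦ ?_⟩
  exact extLinearEquiv_naturality Y n g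
    { hom := lift g _ _
      hom_f_zero_comp_π_f_zero :=
        (lift_commutes_zero _ _ _).trans (by rw [ChainComplex.single₀_map_f_zero]; rfl) } x

end CategoryTheory.ProjectiveResolution

namespace localCohomology

open Abelian Opposite

variable {R : Type} [CommRing R] (J : Ideal R) (M : ModuleCat.{0} R) (i : ℕ)

lemma exists_ext_linearEquiv :
    ∃ e : ∀ t : (ℕᵒᵖ)ᵒᵖ, ((diagram (idealPowersDiagram J) i).obj t).obj M ≃ₗ[R]
      Ext ((ringModIdeals (idealPowersDiagram J)).obj t.unop) M i,
    ∀ ⦃t s : (ℕᵒᵖ)ᵒᵖ⦄ (f : t ⟶ s) (x : ((diagram (idealPowersDiagram J) i).obj t).obj M),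
      e s (((diagram (idealPowersDiagram J) i).map f).app M x) =
        (Ext.mk₀ ((ringModIdeals (idealPowersDiagram J)).map f.unop)).comp (e t x) (zero_add i) := by
  obtain ⟨e, he⟩ := CategoryTheory.exists_ext_linearEquiv R M i
  exact ⟨fun t ↦ e ((ringModIdeals (idealPowersDiagram J)).obj t.unop), fun t s f x ↦ he _ x⟩

theorem subsingleton_obj
    (h : ∀ t : ℕᵒᵖ, ∃ (s : ℕᵒᵖ) (f : s ⟶ t),
      ∀ x : Ext ((ringModIdeals (idealPowersDiagram J)).obj t) M i,
        (Ext.mk₀ ((ringModIdeals (idealPowersDiagram J)).map f)).comp x (zero_add i) = 0) :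
    Subsingleton ((localCohomology J i).obj M) := by
  obtain ⟨e, he⟩ := exists_ext_linearEquiv J M i
  let D := diagram (idealPowersDiagram J) i
  let G : (ℕᵒᵖ)ᵒᵖ ⥤ ModuleCat.{0} R := D ⋙ (evaluation _ _).obj M
  suffices H : ∀ y : (colimit G : ModuleCat R), y = 0 from
    (colimitObjIsoColimitCompEvaluation D M).toLinearEquiv.toEquiv.subsingleton_congr.2
      ⟨fun a b ↦ (H a).trans (H b).symm⟩
  intro y
  obtain ⟨t, x, rfl⟩ := Concrete.colimit_exists_rep G y
  obtain ⟨s, f, hf⟩ := h t.unop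
  have h1 : (D.map f.op).app M x = 0 := (e (op s)).injective <| by
    rw [map_zero]
    exact (he f.op x).trans (hf _)
  have h2 := congrArg (fun g ↦ g.hom x) (colimit.w G f.op)
  refine h2.symm.trans ?_
  refine (congrArg (fun z ↦ (colimit.ι G (op s)).hom z) h1).trans ?_
  exact map_zero _

theorem nonempty_obj_linearEquiv {E : Type} [AddCommGroup E] [Module R E]
    (c : ∀ t : ℕᵒᵖ, Ext ((ringModIdeals (idealPowersDiagram J)).obj t) M i →ₗ[R] E)
    (hc : ∀ ⦃s t : ℕᵒᵖ⦄ (f : s ⟶ t) (x : Ext ((ringModIdeals (idealPowersDiagram J)).obj t) M i),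
      c s ((Ext.mk₀ ((ringModIdeals (idealPowersDiagram J)).map f)).comp x (zero_add i)) = c t x)
    (hinj : ∀ t, Function.Injective (c t)) (hsurj : ∀ y, ∃ t x, c t x = y) :
    Nonempty ((localCohomology J i).obj M ≃ₗ[R] E) := by
  obtain ⟨e, he⟩ := exists_ext_linearEquiv J M i
  let D := diagram (idealPowersDiagram J) i
  let G : (ℕᵒᵖ)ᵒᵖ ⥤ ModuleCat.{0} R := D ⋙ (evaluation _ _).obj M
  let κ : Cocone G :=
    { pt := ModuleCat.of R E
      ι := { app := fun t ↦ ModuleCat.ofHom (c t.unop ∘ₗ (e t).toLinearMap)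
             naturality := fun t s f ↦ by
              ext x
              exact (congrArg (c s.unop) (he f x)).trans (hc f.unop _) } }
  have hκ (t) (x : G.obj t) : (colimit.desc G κ).hom ((colimit.ι G t).hom x) = c t.unop (e t x) :=
    congrArg (fun g ↦ g.hom x) (colimit.ι_desc κ t)
  refine ⟨(colimitObjIsoColimitCompEvaluation D M).toLinearEquiv ≪≫ₗ
    LinearEquiv.ofBijective (colimit.desc G κ).hom ⟨?_, fun y ↦ ?_⟩⟩
  · refine (injective_iff_map_eq_zero _).2 fun y hy ↦ ?_
    obtain ⟨t, x, rfl⟩ := Concrete.colimit_exists_rep G y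
    have h0 : x = 0 := (e t).injective <| hinj t.unop <| by
      rw [map_zero, map_zero]
      exact (hκ t x).symm.trans hy
    rw [h0]
    exact map_zero _
  · obtain ⟨t, x, rfl⟩ := hsurj y
    obtain ⟨z, rfl⟩ := (e (op t)).surjective x
    exact ⟨(colimit.ι G (op t)).hom z, hκ _ z⟩

end localCohomology

namespace CategoryTheory.Abelian.Ext

section

variable {R : Type*} [CommRing R] {C : Type u} [Category.{v} C] [Abelian C] [HasExt.{w} C]
  [Linear R C]

lemma subsingleton_of_pow_smul_id_eq_zero {N L : C} (r : R) (t : ℕ) (hN : r ^ t • 𝟙 N = 0)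
    [IsIso (r • 𝟙 L)] (i : ℕ) : Subsingleton (Ext N L i) := by
  have hinj (x : Ext N L i) (hx : r • x = 0) : x = 0 := by
    have h : x.comp (mk₀ (r • 𝟙 L)) (add_zero i) = 0 := by
      rw [← smul_eq_comp_mk₀, hx]
    have := congrArg (fun y ↦ y.comp (mk₀ (inv (r • 𝟙 L))) (add_zero i)) h
    simpa using this
  have hpow (n : ℕ) (x : Ext N L i) (hx : r ^ n • x = 0) : x = 0 := by
    induction n with
    | zero => simpa using hx
    | succ n ih => exact ih (hinj _ (by rwa [← mul_smul, ← pow_succ']))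
  refine subsingleton_of_forall_eq 0 fun x ↦ hpow t x ?_
  calc r ^ t • x = r ^ t • (mk₀ (𝟙 N)).comp x (zero_add i) := by rw [mk₀_id_comp]
    _ = (mk₀ (r ^ t • 𝟙 N)).comp x (zero_add i) := by rw [mk₀_smul, smul_comp]
    _ = 0 := by rw [hN, mk₀_zero, zero_comp]

end

section

variable {C : Type u} [Category.{v} C] [Abelian C] [HasExt.{w} C]

lemma subsingleton_zero_of_shortExact {S : ShortComplex C} (hS : S.ShortExact) {N : C}
    (h : Subsingleton (Ext N S.X₂ 0)) : Subsingleton (Ext N S.X₁ 0) :=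
  have := hS.mono_f
  (postcomp_mk₀_injective_of_mono N S.f).subsingleton

lemma comp_extClass_bijective {S : ShortComplex C} (hS : S.ShortExact) {N : C}
    (h : ∀ i, Subsingleton (Ext N S.X₂ i)) (i : ℕ) :
    Function.Bijective fun x : Ext N S.X₃ i ↦ x.comp hS.extClass (rfl : i + 1 = i + 1) := by
  constructor
  · refine (injective_iff_map_eq_zero (hS.extClass.postcomp N (rfl : i + 1 = i + 1))).2
      fun x hx ↦ ?_
    obtain ⟨y, rfl⟩ := covariant_sequence_exact₃ N hS x rfl hx
    rw [Subsingleton.elim y 0, zero_comp]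
  · exact fun x ↦ covariant_sequence_exact₁ N hS x (Subsingleton.elim _ _) rfl

theorem exists_comp_bijective {M L : ℕ → C} (f : ∀ k, M k ⟶ L k) (g : ∀ k, L k ⟶ M (k + 1))
    (w : ∀ k, f k ≫ g k = 0) (m : ℕ) (hS : ∀ k < m, (ShortComplex.mk _ _ (w k)).ShortExact)
    (P : C → Prop) (hP : ∀ N, P N → ∀ k < m, ∀ i, Subsingleton (Ext N (L k) i)) :
    ∃ θ : Ext (M m) (M 0) m, ∀ N, P N →
      (∀ i j (hij : i + m = j), Function.Bijective fun x : Ext N (M m) i ↦ x.comp θ hij) ∧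
      ∀ i < m, Subsingleton (Ext N (M 0) i) := by
  induction m with
  | zero =>
    refine ⟨mk₀ (𝟙 _), fun N _ ↦ ⟨fun i j hij ↦ ?_, fun i hi ↦ by simp at hi⟩⟩
    obtain rfl : i = j := hij
    simp only [comp_mk₀_id]
    exact Function.bijective_id
  | succ m ih =>
    obtain ⟨θ, hθ⟩ := ih (fun k hk ↦ hS k (by lia)) (fun N hN k hk ↦ hP N hN k (by lia))
    refine ⟨(hS m (by lia)).extClass.comp θ (add_comm 1 m),
      fun N hN ↦ ⟨fun i j hij ↦ ?_, fun i hi ↦ ?_⟩⟩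
    · convert ((hθ N hN).1 (i + 1) j (by lia)).comp
        (comp_extClass_bijective (hS m (by lia)) (hP N hN m (by lia)) i) using 2
      exact (comp_assoc _ _ _ rfl (add_comm 1 m) (by lia)).symm
    · obtain hi | rfl := Nat.lt_succ_iff_lt_or_eq.1 hi
      · exact (hθ N hN).2 i hi
      · have := subsingleton_zero_of_shortExact (hS i (by lia)) (hP N hN i (by lia) 0)
        exact ((hθ N hN).1 0 i (by lia)).surjective.subsingleton

end

end CategoryTheory.Abelian.Ext

namespace localCohomology

open Abelian Opposite

variable {R : Type} [CommRing R] (J : Ideal R) (m : ℕ) {M L : ℕ → ModuleCat.{0} R}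

lemma pow_smul_id_ringModIdeals_obj {r : R} (hr : r ∈ J) (t : ℕᵒᵖ) :
    r ^ t.unop • 𝟙 ((ringModIdeals (idealPowersDiagram J)).obj t) = 0 := by
  ext x
  obtain ⟨x, rfl⟩ := Ideal.Quotient.mk_surjective (I := J ^ t.unop) x
  change r ^ t.unop • Ideal.Quotient.mk (J ^ t.unop) x = 0
  rw [← Ideal.Quotient.mk_eq_mk, ← Submodule.Quotient.mk_smul, Ideal.Quotient.mk_eq_mk,
    Ideal.Quotient.eq_zero_iff_mem]
  exact Ideal.mul_mem_right _ _ (Ideal.pow_mem_pow hr _)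

theorem exists_comp_bijective (f : ∀ k, M k ⟶ L k) (g : ∀ k, L k ⟶ M (k + 1))
    (w : ∀ k, f k ≫ g k = 0) (hS : ∀ k < m, (ShortComplex.mk _ _ (w k)).ShortExact)
    (hL : ∀ k < m, ∃ r ∈ J, IsIso (r • 𝟙 (L k))) :
    ∃ θ : Ext (M m) (M 0) m, ∀ t,
      (∀ i j (hij : i + m = j), Function.Bijective
        fun x : Ext ((ringModIdeals (idealPowersDiagram J)).obj t) (M m) i ↦ x.comp θ hij) ∧
      ∀ i < m, Subsingleton (Ext ((ringModIdeals (idealPowersDiagram J)).obj t) (M 0) i) := by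
  obtain ⟨θ, hθ⟩ := Ext.exists_comp_bijective f g w m hS
    (fun N ↦ ∃ t, N = (ringModIdeals (idealPowersDiagram J)).obj t) (by
      rintro _ ⟨t, rfl⟩ k hk i
      obtain ⟨r, hr, hr'⟩ := hL k hk
      exact Ext.subsingleton_of_pow_smul_id_eq_zero r _ (pow_smul_id_ringModIdeals_obj J hr t) i)
  exact ⟨θ, fun t ↦ hθ _ ⟨t, rfl⟩⟩

theorem subsingleton_obj_of_lt (f : ∀ k, M k ⟶ L k) (g : ∀ k, L k ⟶ M (k + 1))
    (w : ∀ k, f k ≫ g k = 0) (hS : ∀ k < m, (ShortComplex.mk _ _ (w k)).ShortExact)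
    (hL : ∀ k < m, ∃ r ∈ J, IsIso (r • 𝟙 (L k))) (i : ℕ) (hi : i < m) :
    Subsingleton ((localCohomology J i).obj (M 0)) := by
  obtain ⟨θ, hθ⟩ := exists_comp_bijective J m f g w hS hL
  exact subsingleton_obj J _ i fun t ↦ ⟨t, 𝟙 _, fun x ↦ ((hθ t).2 i hi).elim _ _⟩

theorem nonempty_obj_linearEquiv_of_torsion (f : ∀ k, M k ⟶ L k) (g : ∀ k, L k ⟶ M (k + 1))
    (w : ∀ k, f k ≫ g k = 0) (hS : ∀ k < m, (ShortComplex.mk _ _ (w k)).ShortExact)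
    (hL : ∀ k < m, ∃ r ∈ J, IsIso (r • 𝟙 (L k)))
    (hM : ∀ x : M m, ∃ t, ∀ r ∈ J ^ t, r • x = 0) :
    Nonempty ((localCohomology J m).obj (M 0) ≃ₗ[R] M m) := by
  obtain ⟨θ, hθ⟩ := exists_comp_bijective J m f g w hS hL
  let N := ringModIdeals (idealPowersDiagram J)
  let φ (t : ℕᵒᵖ) : (N.obj t ⟶ M m) ≃ₗ[R] Ext (N.obj t) (M 0) m :=
    (Ext.linearEquiv₀ (R := R)).symm ≪≫ₗ LinearEquiv.ofBijective
      { toFun := fun x ↦ x.comp θ (zero_add m)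
        map_add' := fun x y ↦ Ext.add_comp _ _ _ _
        map_smul' := fun r x ↦ Ext.smul_comp _ _ _ _ } ((hθ t).1 0 m (zero_add m))
  have hφ (t) (h) : φ t h = (Ext.mk₀ h).comp θ (zero_add m) := rfl
  let ev (t : ℕᵒᵖ) : (N.obj t ⟶ M m) →ₗ[R] M m :=
    { toFun := fun h ↦ h.hom (Ideal.Quotient.mk (J ^ t.unop) 1)
      map_add' := fun _ _ ↦ rfl
      map_smul' := fun _ _ ↦ rfl }
  refine nonempty_obj_linearEquiv J (M 0) m (fun t ↦ ev t ∘ₗ (φ t).symm.toLinearMap) ?_ ?_ ?_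
  · intro s t h x
    obtain ⟨x, rfl⟩ := (φ t).surjective x
    have : (Ext.mk₀ (N.map h)).comp (φ t x) (zero_add m) = φ s (N.map h ≫ x) := by
      rw [hφ, hφ, ← Ext.comp_assoc _ _ _ (zero_add 0) (zero_add m) (by lia), Ext.mk₀_comp_mk₀]
    change ev s ((φ s).symm _) = ev t ((φ t).symm _)
    rw [this, LinearEquiv.symm_apply_apply, LinearEquiv.symm_apply_apply]
    rfl
  · refine fun t ↦ Function.Injective.comp (g := ev t) ?_ (φ t).symm.injective
    intro x y hxy
    ext a
    obtain ⟨a, rfl⟩ := Ideal.Quotient.mk_surjective (I := J ^ t.unop) a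
    have ha : Ideal.Quotient.mk (J ^ t.unop) a = a • Ideal.Quotient.mk (J ^ t.unop) 1 :=
      congrArg (Ideal.Quotient.mk (J ^ t.unop)) (mul_one a).symm
    rw [ha]
    exact (map_smul x.hom a _).trans ((congrArg (a • ·) hxy).trans (map_smul y.hom a _).symm)
  · intro y
    obtain ⟨t, ht⟩ := hM y
    let h : N.obj (op t) ⟶ M m := ModuleCat.ofHom
      ((J ^ t).liftQ (LinearMap.toSpanSingleton R (M m) y) fun r hr ↦ ht r hr)
    refine ⟨op t, φ _ h, ?_⟩
    change ev _ ((φ _).symm _) = y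
    rw [LinearEquiv.symm_apply_apply]
    exact one_smul R y

theorem subsingleton_obj_of_hasProjectiveDimensionLT (X : ModuleCat.{0} R) (i : ℕ)
    (h : ∀ t, ∃ s, ∃ K : Ideal R, t ≤ s ∧ J ^ s ≤ K ∧ K ≤ J ^ t ∧
      HasProjectiveDimensionLT (ModuleCat.of R (R ⧸ K)) i) :
    Subsingleton ((localCohomology J i).obj X) := by
  refine subsingleton_obj J X i fun t ↦ ?_
  obtain ⟨s, K, hts, hsK, hKt, hK⟩ := h t.unop
  refine ⟨op s, (homOfLE hts).op, fun x ↦ ?_⟩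
  let α : (ringModIdeals (idealPowersDiagram J)).obj (op s) ⟶ ModuleCat.of R (R ⧸ K) :=
    ModuleCat.ofHom (Submodule.mapQ (J ^ s) K LinearMap.id hsK)
  let β : ModuleCat.of R (R ⧸ K) ⟶ (ringModIdeals (idealPowersDiagram J)).obj t :=
    ModuleCat.ofHom (Submodule.mapQ K (J ^ t.unop) LinearMap.id hKt)
  have hαβ : (ringModIdeals (idealPowersDiagram J)).map (homOfLE hts).op = α ≫ β := by
    ext a
    obtain ⟨a, rfl⟩ := Ideal.Quotient.mk_surjective (I := J ^ s) a
    rfl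
  have := HasProjectiveDimensionLT.subsingleton (ModuleCat.of R (R ⧸ K)) i i le_rfl X
  refine (congrArg (fun y ↦ (Ext.mk₀ y).comp x (zero_add i)) hαβ).trans ?_
  rw [← Ext.mk₀_comp_mk₀, Ext.comp_assoc _ _ _ (zero_add 0) (zero_add i) (by lia),
    Subsingleton.elim ((Ext.mk₀ β).comp x (zero_add i)) 0, Ext.comp_zero]

end localCohomology

namespace LaurentPoly

variable {A : Type} [CommRing A] {m : ℕ}

instance : Algebra (MvPolynomial (Fin m) A) (AddMonoidAlgebra A (Fin m → ℤ)) :=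
  (aeval fun i ↦ AddMonoidAlgebra.single (Pi.single i 1) (1 : A)).toAlgebra

lemma algebraMap_X (i : Fin m) :
    algebraMap (MvPolynomial (Fin m) A) (AddMonoidAlgebra A (Fin m → ℤ)) (X i) =
      AddMonoidAlgebra.single (Pi.single i 1) 1 :=
  aeval_X _ i

instance : IsScalarTower A (MvPolynomial (Fin m) A) (AddMonoidAlgebra A (Fin m → ℤ)) :=
  .of_algHom (aeval fun i ↦ AddMonoidAlgebra.single (Pi.single i 1) (1 : A))

lemma algebraMap_X_pow (i : Fin m) (n : ℕ) :
    algebraMap (MvPolynomial (Fin m) A) (AddMonoidAlgebra A (Fin m → ℤ)) (X i ^ n) =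
      AddMonoidAlgebra.single (Pi.single i (n : ℤ)) 1 := by
  rw [map_pow, algebraMap_X, AddMonoidAlgebra.single_pow, one_pow, ← Pi.single_smul]
  simp

lemma algebraMap_monomial (s : Fin m →₀ ℕ) (c : A) :
    algebraMap (MvPolynomial (Fin m) A) (AddMonoidAlgebra A (Fin m → ℤ)) (monomial s c) =
      AddMonoidAlgebra.single (fun i ↦ (s i : ℤ)) c := by
  rw [monomial_eq, map_mul, Finsupp.prod_fintype _ _ (by simp), map_prod]
  simp_rw [algebraMap_X_pow]
  rw [AddMonoidAlgebra.prod_single, ← algebraMap_eq, ← IsScalarTower.algebraMap_apply,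
    AddMonoidAlgebra.coe_algebraMap]
  simp [AddMonoidAlgebra.single_mul_single, Finset.univ_sum_single (fun i ↦ (s i : ℤ))]

lemma coeff_X_pow_smul (i : Fin m) (n : ℕ) (f : AddMonoidAlgebra A (Fin m → ℤ)) (a : Fin m → ℤ) :
    ((X i ^ n : MvPolynomial (Fin m) A) • f).coeff a = f.coeff (a - Pi.single i (n : ℤ)) := by
  rw [Algebra.smul_def, algebraMap_X_pow, AddMonoidAlgebra.coeff_single_mul_apply, one_mul,
    neg_add_eq_sub]

lemma coeff_X_smul (i : Fin m) (f : AddMonoidAlgebra A (Fin m → ℤ)) (a : Fin m → ℤ) :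
    ((X i : MvPolynomial (Fin m) A) • f).coeff a = f.coeff (a - Pi.single i 1) := by
  simpa using coeff_X_pow_smul i 1 f a

lemma coeff_algebraMap (p : MvPolynomial (Fin m) A) (s : Fin m →₀ ℕ) :
    (algebraMap (MvPolynomial (Fin m) A) (AddMonoidAlgebra A (Fin m → ℤ)) p).coeff
      (fun i ↦ (s i : ℤ)) = p.coeff s := by
  induction p using MvPolynomial.induction_on' with
  | monomial u c =>
    classical
    rw [algebraMap_monomial, AddMonoidAlgebra.coeff_single, Finsupp.single_apply, coeff_monomial]
    simp [funext_iff, Finsupp.ext_iff]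
  | add p q hp hq => rw [map_add, AddMonoidAlgebra.coeff_add, Finsupp.add_apply, hp, hq, coeff_add]

variable (A) in
/-- The Laurent polynomials all of whose exponents lie in the upper set `U`. -/
def supported (U : UpperSet (Fin m → ℤ)) :
    Submodule (MvPolynomial (Fin m) A) (AddMonoidAlgebra A (Fin m → ℤ)) where
  carrier := {f | ∀ a ∉ U, f.coeff a = 0}
  zero_mem' := fun _ _ ↦ rfl
  add_mem' := fun {f g} hf hg a ha ↦ by
    rw [AddMonoidAlgebra.coeff_add, Finsupp.add_apply, hf a ha, hg a ha, add_zero]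
  smul_mem' := fun p f hf ↦ by
    induction p using MvPolynomial.induction_on generalizing f with
    | C c =>
      intro a ha
      rw [← algebraMap_eq, algebraMap_smul, AddMonoidAlgebra.coeff_smul_apply, hf a ha, smul_zero]
    | add p q hp hq =>
      intro a ha
      rw [add_smul, AddMonoidAlgebra.coeff_add, Finsupp.add_apply, hp f hf a ha, hq f hf a ha,
        add_zero]
    | mul_X p i hp =>
      rw [mul_smul]
      refine hp _ fun a ha ↦ ?_
      rw [coeff_X_smul]
      refine hf _ fun h ↦ ha (U.upper ?_ h)
      simp [Pi.single_nonneg]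

variable {U U' W W' : UpperSet (Fin m → ℤ)} {f : AddMonoidAlgebra A (Fin m → ℤ)}

lemma supported_mono (h : U' ≤ U) : supported A U ≤ supported A U' :=
  fun _ hf a ha ↦ hf a fun h₁ ↦ ha (h h₁)

/-- If all exponents of `f` lie in the union of two upper sets, then `f` decomposes accordingly. -/
lemma exists_add_eq (h : ∀ a, f.coeff a ≠ 0 → a ∈ U ∨ a ∈ W) :
    ∃ g ∈ supported A U, f - g ∈ supported A W ∧
      ∀ a, g.coeff a ≠ 0 → f.coeff a ≠ 0 ∧ a ∉ W := by
  classical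
  refine ⟨.ofCoeff (f.coeff.filter (· ∉ W)), fun a ha ↦ ?_, fun a ha ↦ ?_, fun a ha ↦ ?_⟩
  · rw [AddMonoidAlgebra.coeff_ofCoeff, Finsupp.filter_apply]
    split_ifs with h'
    · rfl
    · by_contra h0
      exact (h a h0).elim ha h'
  · rw [AddMonoidAlgebra.coeff_sub, Finsupp.sub_apply, AddMonoidAlgebra.coeff_ofCoeff,
      Finsupp.filter_apply_pos (p := (· ∉ W)) _ ha, sub_self]
  · rw [AddMonoidAlgebra.coeff_ofCoeff, Finsupp.filter_apply] at ha
    split_ifs at ha with h'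
    · exact absurd rfl ha
    · exact ⟨ha, h'⟩

variable (A) in
/-- The subquotient of the Laurent polynomial ring with basis the monomials with exponents in `U`
but not in `W`. -/
abbrev Subquotient (U W : UpperSet (Fin m → ℤ)) : Type :=
  supported A U ⧸ (supported A W).submoduleOf (supported A U)

namespace Subquotient

lemma mk_eq_zero {x : supported A U} :
    (Submodule.Quotient.mk x : Subquotient A U W) = 0 ↔ x.1 ∈ supported A W :=
  Submodule.Quotient.mk_eq_zero _

variable (A) in
/-- The map of subquotients induced by inclusions of upper sets. -/
def map (h : U' ≤ U) (h' : W' ≤ W) :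
    Subquotient A U W →ₗ[MvPolynomial (Fin m) A] Subquotient A U' W' :=
  Submodule.mapQ _ _ (Submodule.inclusion (supported_mono h)) fun _ hx ↦ supported_mono h' hx

variable (A) in
lemma map_comp_map_eq_zero (h : U' ≤ U) (h' : W' ≤ W) (hUW : W' ≤ U) :
    ModuleCat.ofHom (map A h (le_refl W)) ≫ ModuleCat.ofHom (map A (le_refl U') h') = 0 := by
  ext x
  exact mk_eq_zero.2 (supported_mono hUW x.2)

variable (A) in
lemma shortExact (h : U' ≤ U) (h' : W' ≤ W)
    (hU' : ∀ a ∈ U', a ∈ W' → a ∈ U ∨ a ∈ W)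
    (w : ModuleCat.ofHom (map A h (le_refl W)) ≫ ModuleCat.ofHom (map A (le_refl U') h') = 0) :
    (ShortComplex.mk _ _ w).ShortExact := by
  refine { exact := ?_, mono_f := ?_, epi_g := ?_ }
  · rw [ShortComplex.moduleCat_exact_iff]
    intro x hx
    obtain ⟨x, rfl⟩ := Submodule.Quotient.mk_surjective _ x
    have hx' : x.1 ∈ supported A W' := mk_eq_zero.1 hx
    obtain ⟨g, hg, hxg, -⟩ := exists_add_eq (A := A) (f := x.1) (U := U) (W := W) fun a ha ↦
      hU' a (by_contra fun h ↦ ha (x.2 a h)) (by_contra fun h ↦ ha (hx' a h))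
    refine ⟨Submodule.Quotient.mk ⟨g, hg⟩, (Submodule.Quotient.eq _).2 ?_⟩
    change g - x.1 ∈ supported A W
    rw [← neg_sub]
    exact neg_mem hxg
  · rw [ModuleCat.mono_iff_injective]
    refine (injective_iff_map_eq_zero (map A h (le_refl W))).2 fun x hx ↦ ?_
    obtain ⟨x, rfl⟩ := Submodule.Quotient.mk_surjective _ x
    have hx' : (Submodule.inclusion (supported_mono h) x).1 ∈ supported A W := mk_eq_zero.1 hx
    exact mk_eq_zero.2 hx'
  · rw [ModuleCat.epi_iff_surjective]
    intro x
    obtain ⟨x, rfl⟩ := Submodule.Quotient.mk_surjective _ x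
    exact ⟨Submodule.Quotient.mk x, rfl⟩

lemma X_pow_smul_injective (i : Fin m) (n : ℕ)
    (hW : ∀ a ∈ W, ∀ z, a + Pi.single i z ∈ W) :
    Function.Injective fun x : Subquotient A U W ↦ (X i ^ n : MvPolynomial (Fin m) A) • x := by
  refine (injective_iff_map_eq_zero (LinearMap.lsmul _ (Subquotient A U W) (X i ^ n))).2
    fun x hx ↦ ?_
  obtain ⟨x, rfl⟩ := Submodule.Quotient.mk_surjective _ x
  have hx' : (X i ^ n : MvPolynomial (Fin m) A) • x.1 ∈ supported A W := mk_eq_zero.1 hx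
  refine mk_eq_zero.2 fun a ha ↦ ?_
  have := hx' (a + Pi.single i (n : ℤ)) fun h ↦ ha (by
    simpa [Pi.single_neg] using hW _ h (-n))
  rwa [coeff_X_pow_smul, add_sub_cancel_right] at this

/-- Divisibility by a power of a variable inside `supported A U`. -/
lemma exists_X_pow_smul_eq (i : Fin m) (n : ℕ)
    (h : ∀ a, f.coeff a ≠ 0 → a - Pi.single i (n : ℤ) ∈ U) :
    ∃ g ∈ supported A U, (X i ^ n : MvPolynomial (Fin m) A) • g = f := by
  have key (a : Fin m → ℤ) :
      (AddMonoidAlgebra.single (-Pi.single i (n : ℤ)) 1 * f).coeff a =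
        f.coeff (a + Pi.single i (n : ℤ)) := by
    rw [AddMonoidAlgebra.coeff_single_mul_apply, one_mul, neg_neg, add_comm]
  refine ⟨.single (-Pi.single i (n : ℤ)) 1 * f, fun a ha ↦ ?_, ?_⟩
  · rw [key]
    by_contra h0
    exact ha (by simpa using h _ h0)
  · ext a
    rw [coeff_X_pow_smul, key, sub_add_cancel]

lemma X_smul_bijective (i : Fin m) (hU : ∀ a ∈ U, ∀ z, a + Pi.single i z ∈ U)
    (hW : ∀ a ∈ W, ∀ z, a + Pi.single i z ∈ W) :
    Function.Bijective fun x : Subquotient A U W ↦ (X i : MvPolynomial (Fin m) A) • x := by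
  refine ⟨by simpa using X_pow_smul_injective (A := A) (U := U) i 1 hW, fun x ↦ ?_⟩
  obtain ⟨x, rfl⟩ := Submodule.Quotient.mk_surjective _ x
  obtain ⟨g, hg, hgx⟩ := exists_X_pow_smul_eq (A := A) (f := x.1) (U := U) i 1 fun a ha ↦ by
    simpa [Pi.single_neg, sub_eq_add_neg] using
      hU a (by_contra fun h ↦ ha (x.2 a h)) (-1)
  refine ⟨Submodule.Quotient.mk ⟨g, hg⟩, ?_⟩
  change Submodule.Quotient.mk _ = _
  congr 1
  exact Subtype.ext (by simpa using hgx)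

end Subquotient

end LaurentPoly

namespace LaurentPoly

variable (A : Type) [CommRing A] (m : ℕ)

/-- The exponents whose entries from position `k` on are nonnegative. -/
def nonnegFrom (k : ℕ) : UpperSet (Fin m → ℤ) where
  carrier := {a | ∀ i : Fin m, k ≤ i → 0 ≤ a i}
  upper' := fun _ _ hab ha i hi ↦ (ha i hi).trans (hab i)

/-- The exponents for which some entry before position `k` is at least `t` (all exponents, if `k`
exceeds the number of variables). -/
def someGeBefore (t : ℤ) (k : ℕ) : UpperSet (Fin m → ℤ) where
  carrier := {a | m < k ∨ ∃ i : Fin m, i < k ∧ t ≤ a i}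
  upper' := fun _ _ hab ha ↦ ha.imp_right fun ⟨i, hi, h⟩ ↦ ⟨i, hi, h.trans (hab i)⟩

variable {m}

lemma mem_someGeBefore {t : ℤ} {k : ℕ} {a : Fin m → ℤ} :
    a ∈ someGeBefore m t k ↔ m < k ∨ ∃ i : Fin m, i < k ∧ t ≤ a i := Iff.rfl

lemma nonnegFrom_succ_le (k : ℕ) : nonnegFrom m (k + 1) ≤ nonnegFrom m k :=
  fun _ ha i hi ↦ ha i (by lia)

lemma someGeBefore_succ_le (t : ℤ) (k : ℕ) : someGeBefore m t (k + 1) ≤ someGeBefore m t k :=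
  fun _ ha ↦ ha.imp (by lia) fun ⟨i, hi, h⟩ ↦ ⟨i, by lia, h⟩

lemma someGeBefore_succ_le_nonnegFrom (k : ℕ) : someGeBefore m 0 (k + 1) ≤ nonnegFrom m k := by
  intro a ha
  by_cases hk : k < m
  · exact .inr ⟨⟨k, hk⟩, by simp, ha _ le_rfl⟩
  · exact .inl (by lia)

lemma mem_or_mem_of_mem_someGeBefore_succ {t : ℤ} {k : ℕ} (hk : k < m) {a : Fin m → ℤ}
    (ha : a ∈ someGeBefore m t (k + 1)) : t ≤ a ⟨k, hk⟩ ∨ a ∈ someGeBefore m t k := by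
  obtain h | ⟨i, hi, h⟩ := ha
  · lia
  · obtain h' | h' := Nat.lt_succ_iff_lt_or_eq.1 hi
    · exact .inr (.inr ⟨i, h', h⟩)
    · obtain rfl : i = ⟨k, hk⟩ := Fin.ext h'
      exact .inl h

lemma add_single_mem_nonnegFrom {k : ℕ} (hk : k < m) (a : Fin m → ℤ)
    (ha : a ∈ nonnegFrom m (k + 1)) (z : ℤ) : a + Pi.single ⟨k, hk⟩ z ∈ nonnegFrom m (k + 1) := by
  intro i hi
  have : i ≠ ⟨k, hk⟩ := by rintro rfl; simp at hi
  simpa [this] using ha i hi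

lemma add_single_mem_someGeBefore {t : ℤ} {k : ℕ} (hk : k < m) (a : Fin m → ℤ)
    (ha : a ∈ someGeBefore m t k) (z : ℤ) : a + Pi.single ⟨k, hk⟩ z ∈ someGeBefore m t k := by
  refine ha.imp_right fun ⟨i, hi, h⟩ ↦ ⟨i, hi, ?_⟩
  have : i ≠ ⟨k, hk⟩ := by rintro rfl; simp at hi
  simpa [this] using h

lemma notMem_someGeBefore_zero (t : ℤ) (a : Fin m → ℤ) : a ∉ someGeBefore m t 0 := by
  simp [mem_someGeBefore]

lemma mem_supported_nonnegFrom_zero (p : MvPolynomial (Fin m) A) :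
    algebraMap _ (AddMonoidAlgebra A (Fin m → ℤ)) p ∈ supported A (nonnegFrom m 0) := by
  rw [Algebra.algebraMap_eq_smul_one]
  refine Submodule.smul_mem _ _ fun a ha ↦ ?_
  rw [AddMonoidAlgebra.one_def, AddMonoidAlgebra.coeff_single, Finsupp.single_eq_of_ne]
  rintro rfl
  exact ha fun _ _ ↦ le_rfl

/-- Polynomials are the Laurent polynomials with nonnegative exponents. -/
def polyEquiv : MvPolynomial (Fin m) A ≃ₗ[MvPolynomial (Fin m) A] supported A (nonnegFrom m 0) :=
  LinearEquiv.ofBijective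
    ((Algebra.linearMap _ (AddMonoidAlgebra A (Fin m → ℤ))).codRestrict _
      (mem_supported_nonnegFrom_zero A)) <| by
    constructor
    · intro p q hpq
      ext s
      rw [← coeff_algebraMap, ← coeff_algebraMap]
      exact congrArg (fun x ↦ x.1.coeff (fun i ↦ (s i : ℤ))) hpq
    · rintro ⟨f, hf⟩
      suffices ∃ p, algebraMap (MvPolynomial (Fin m) A) (AddMonoidAlgebra A (Fin m → ℤ)) p = f from
        this.imp fun p hp ↦ Subtype.ext hp
      rw [← AddMonoidAlgebra.sum_coeff_single f, ← RingHom.mem_range]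
      refine sum_mem fun a ha ↦ ?_
      have ha' : a ∈ nonnegFrom m 0 := by_contra fun h ↦ Finsupp.mem_support_iff.1 ha (hf a h)
      refine ⟨monomial (Finsupp.equivFunOnFinite.symm fun i ↦ (a i).toNat) (f.coeff a), ?_⟩
      rw [algebraMap_monomial]
      congr
      ext i
      simpa using ha' i (Nat.zero_le _)

/-- The module interpolating between the polynomial ring and its top local cohomology. -/
abbrev interpolant (k : ℕ) : ModuleCat.{0} (MvPolynomial (Fin m) A) :=
  ModuleCat.of _ (Subquotient A (nonnegFrom m k) (someGeBefore m 0 k))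

/-- The localization of `interpolant A k` at the `k`-th variable. -/
abbrev interpolantLoc (k : ℕ) : ModuleCat.{0} (MvPolynomial (Fin m) A) :=
  ModuleCat.of _ (Subquotient A (nonnegFrom m (k + 1)) (someGeBefore m 0 k))

variable (m) in
/-- The ideal of the origin of affine space. -/
abbrev originIdeal : Ideal (MvPolynomial (Fin m) A) :=
  Ideal.span (Set.range (X : Fin m → MvPolynomial (Fin m) A))

lemma exists_isIso_smul_id_interpolantLoc (k : ℕ) (hk : k < m) :
    ∃ r ∈ originIdeal A m, IsIso (r • 𝟙 (interpolantLoc A (m := m) k)) := by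
  refine ⟨X ⟨k, hk⟩, Ideal.subset_span ⟨_, rfl⟩, ?_⟩
  rw [ConcreteCategory.isIso_iff_bijective]
  exact Subquotient.X_smul_bijective _ (add_single_mem_nonnegFrom hk)
    (add_single_mem_someGeBefore hk)

lemma shortExact_interpolant (k : ℕ) (hk : k < m) :
    (ShortComplex.mk _ _ (Subquotient.map_comp_map_eq_zero A (nonnegFrom_succ_le (m := m) k)
      (someGeBefore_succ_le 0 k) (someGeBefore_succ_le_nonnegFrom k))).ShortExact := by
  refine Subquotient.shortExact A _ _ (fun a ha ha' ↦ ?_) _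
  refine (mem_or_mem_of_mem_someGeBefore_succ hk ha').imp_left fun h i hi ↦ ?_
  obtain hki | hki := hi.eq_or_lt
  · obtain rfl : i = ⟨k, hk⟩ := Fin.ext hki.symm
    exact h
  · exact ha i hki

/-- The polynomial ring as the subquotient with no relations. -/
def polyEquivSubquotient (t : ℤ) : MvPolynomial (Fin m) A ≃ₗ[MvPolynomial (Fin m) A]
    Subquotient A (nonnegFrom m 0) (someGeBefore m t 0) :=
  polyEquiv A ≪≫ₗ (Submodule.quotEquivOfEqBot _ (by
    rw [eq_bot_iff]
    intro x hx
    ext a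
    exact hx a (notMem_someGeBefore_zero t a))).symm

variable (m) in
theorem subsingleton_of_lt (i : ℕ) (hi : i < m) :
    Subsingleton ((localCohomology (originIdeal A m) i).obj
      (ModuleCat.of _ (MvPolynomial (Fin m) A))) := by
  have := localCohomology.subsingleton_obj_of_lt (originIdeal A m) m _ _ _
    (shortExact_interpolant A) (exists_isIso_smul_id_interpolantLoc A) i hi
  exact ((localCohomology (originIdeal A m) i).mapIso
    (polyEquivSubquotient A 0).toModuleIso).toLinearEquiv.toEquiv.subsingleton

lemma exists_X_pow_smul_eq_zero (j : Fin m) (x : Subquotient A (nonnegFrom m m)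
    (someGeBefore m 0 m)) : ∃ n, (X j ^ n : MvPolynomial (Fin m) A) • x = 0 := by
  obtain ⟨x, rfl⟩ := Submodule.Quotient.mk_surjective _ x
  obtain ⟨n, hn⟩ : ∃ n : ℕ, ∀ a ∈ x.1.coeff.support, - a j ≤ n := by
    obtain ⟨N, hN⟩ := (x.1.coeff.support.image fun a ↦ - a j).exists_le
    exact ⟨N.toNat, fun a ha ↦ (hN _ (Finset.mem_image_of_mem _ ha)).trans (Int.self_le_toNat N)⟩
  refine ⟨n, Subquotient.mk_eq_zero.2 fun a ha ↦ ?_⟩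
  change ((X j ^ n : MvPolynomial (Fin m) A) • x.1).coeff a = 0
  rw [coeff_X_pow_smul]
  by_contra h
  have := hn _ (Finsupp.mem_support_iff.2 h)
  simp only [Pi.sub_apply, Pi.single_eq_same] at this
  exact ha (.inr ⟨j, j.2, by lia⟩)

variable {A} in
lemma exists_originIdeal_pow_le (K : Ideal (MvPolynomial (Fin m) A))
    (h : ∀ j, ∃ n, (X j ^ n : MvPolynomial (Fin m) A) ∈ K) : ∃ t, originIdeal A m ^ t ≤ K :=
  Ideal.exists_pow_le_of_le_radical_of_fg
    (Ideal.span_le.2 (by rintro _ ⟨j, rfl⟩; exact h j)) (Submodule.fg_span (Set.finite_range _))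

variable (m) in
theorem nonempty_linearEquiv :
    Nonempty ((localCohomology (originIdeal A m) m).obj
      (ModuleCat.of _ (MvPolynomial (Fin m) A)) ≃ₗ[MvPolynomial (Fin m) A]
        Subquotient A (nonnegFrom m m) (someGeBefore m 0 m)) := by
  obtain ⟨e⟩ := localCohomology.nonempty_obj_linearEquiv_of_torsion (originIdeal A m) m _ _ _
    (shortExact_interpolant A) (exists_isIso_smul_id_interpolantLoc A) fun x ↦ by
      obtain ⟨t, ht⟩ := exists_originIdeal_pow_le
        (LinearMap.ker (LinearMap.toSpanSingleton (MvPolynomial (Fin m) A) _ x))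
        fun j ↦ exists_X_pow_smul_eq_zero A j x
      exact ⟨t, fun r hr ↦ ht hr⟩
  exact ⟨((localCohomology (originIdeal A m) m).mapIso
    (polyEquivSubquotient A 0).toModuleIso).toLinearEquiv ≪≫ₗ e⟩

end LaurentPoly

namespace LaurentPoly

variable (A : Type) [CommRing A] {m : ℕ}

/-- The quotient of the polynomial ring by the `t`-th powers of the first `k` variables. -/
abbrev powerQuotient (t k : ℕ) : ModuleCat.{0} (MvPolynomial (Fin m) A) :=
  ModuleCat.of _ (Subquotient A (nonnegFrom m 0) (someGeBefore m t k))

lemma exists_shortExact_powerQuotient (t k : ℕ) (hk : k < m) :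
    ∃ (f : powerQuotient A (m := m) t k ⟶ powerQuotient A t k)
      (g : powerQuotient A t k ⟶ powerQuotient A t (k + 1)) (w : f ≫ g = 0),
      (ShortComplex.mk f g w).ShortExact := by
  let f : powerQuotient A (m := m) t k ⟶ powerQuotient A t k :=
    ModuleCat.ofHom (LinearMap.lsmul _ _ (X ⟨k, hk⟩ ^ t : MvPolynomial (Fin m) A))
  let g : powerQuotient A (m := m) t k ⟶ powerQuotient A t (k + 1) :=
    ModuleCat.ofHom (Subquotient.map A le_rfl (someGeBefore_succ_le t k))
  have w : f ≫ g = 0 := by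
    ext x
    refine Subquotient.mk_eq_zero.2 fun a ha ↦ ?_
    change ((X ⟨k, hk⟩ ^ t : MvPolynomial (Fin m) A) • x.1).coeff a = 0
    rw [coeff_X_pow_smul]
    refine x.2 _ fun h ↦ ha (.inr ⟨⟨k, hk⟩, by simp, ?_⟩)
    simpa using h ⟨k, hk⟩ (Nat.zero_le _)
  refine ⟨f, g, w, { exact := ?_, mono_f := ?_, epi_g := ?_ }⟩
  · rw [ShortComplex.moduleCat_exact_iff]
    intro x hx
    obtain ⟨x, rfl⟩ := Submodule.Quotient.mk_surjective _ x
    have hx' : x.1 ∈ supported A (someGeBefore m t (k + 1)) := Subquotient.mk_eq_zero.1 hx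
    have hx0 (a) (ha : x.1.coeff a ≠ 0) : a ∈ nonnegFrom m 0 := by_contra fun h ↦ ha (x.2 a h)
    obtain ⟨y, -, hxy, hy⟩ := exists_add_eq (A := A) (f := x.1) (U := nonnegFrom m 0)
      (W := someGeBefore m t k) fun a ha ↦ .inl (hx0 a ha)
    obtain ⟨z, hz, rfl⟩ := Subquotient.exists_X_pow_smul_eq (A := A) (f := y)
      (U := nonnegFrom m 0) ⟨k, hk⟩ t fun a ha i _ ↦ by
        obtain ⟨ha, ha'⟩ := hy a ha
        have h1 := (mem_or_mem_of_mem_someGeBefore_succ hk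
          (by_contra fun h ↦ ha (hx' a h))).resolve_right ha'
        have h2 := hx0 a ha i (Nat.zero_le _)
        by_cases hi : i = ⟨k, hk⟩
        · subst hi
          simpa using h1
        · simpa [hi] using h2
    refine ⟨Submodule.Quotient.mk ⟨z, hz⟩, (Submodule.Quotient.eq _).2 ?_⟩
    change _ - x.1 ∈ supported A (someGeBefore m t k)
    rw [← neg_sub]
    exact neg_mem hxy
  · rw [ModuleCat.mono_iff_injective]
    exact Subquotient.X_pow_smul_injective _ _ (add_single_mem_someGeBefore hk)
  · rw [ModuleCat.epi_iff_surjective]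
    intro x
    obtain ⟨x, rfl⟩ := Submodule.Quotient.mk_surjective _ x
    exact ⟨Submodule.Quotient.mk x, rfl⟩

lemma hasProjectiveDimensionLT_powerQuotient (t k : ℕ) (hk : k ≤ m) :
    HasProjectiveDimensionLT (powerQuotient A (m := m) t k) (k + 1) := by
  induction k with
  | zero =>
    exact hasProjectiveDimensionLT_of_iso (polyEquivSubquotient A t).toModuleIso 1
  | succ k ih =>
    obtain ⟨f, g, w, h⟩ := exists_shortExact_powerQuotient A t k hk
    have := ih (by lia)
    exact h.hasProjectiveDimensionLT_X₃ _ this (hasProjectiveDimensionLT_of_ge _ (k + 1) _ (by lia))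

/-- The projection from the polynomial ring. -/
def polyToPowerQuotient (t : ℕ) :
    MvPolynomial (Fin m) A →ₗ[MvPolynomial (Fin m) A] powerQuotient A (m := m) t m :=
  Submodule.mkQ _ ∘ₗ (polyEquiv A).toLinearMap

lemma mem_ker_polyToPowerQuotient {t : ℕ} {p : MvPolynomial (Fin m) A} :
    p ∈ LinearMap.ker (polyToPowerQuotient A t) ↔
      algebraMap _ (AddMonoidAlgebra A (Fin m → ℤ)) p ∈ supported A (someGeBefore m t m) :=
  Subquotient.mk_eq_zero

lemma ker_polyToPowerQuotient_le (t : ℕ) :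
    LinearMap.ker (polyToPowerQuotient A (m := m) t) ≤ originIdeal A m ^ t := by
  intro p hp
  rw [mem_ker_polyToPowerQuotient] at hp
  rw [p.as_sum]
  refine sum_mem fun s hs ↦ ?_
  have hs' : (fun i ↦ (s i : ℤ)) ∈ someGeBefore m t m := by
    by_contra h
    have := hp _ h
    rw [coeff_algebraMap] at this
    exact mem_support_iff.1 hs this
  obtain h | ⟨j, -, hj⟩ := hs'
  · exact absurd h (lt_irrefl _)
  · have hj' : Finsupp.single j t ≤ s := by simpa using hj
    rw [← tsub_add_cancel_of_le hj', ← mul_one (coeff _ p), ← monomial_mul, ← X_pow_eq_monomial]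
    exact Ideal.mul_mem_left _ _
      (Ideal.pow_mem_pow (Ideal.subset_span (Set.mem_range_self j)) _)

lemma X_pow_mem_ker_polyToPowerQuotient (t : ℕ) (j : Fin m) :
    (X j ^ t : MvPolynomial (Fin m) A) ∈ LinearMap.ker (polyToPowerQuotient A t) := by
  rw [mem_ker_polyToPowerQuotient, algebraMap_X_pow]
  intro a ha
  rw [AddMonoidAlgebra.coeff_single, Finsupp.single_eq_of_ne]
  rintro rfl
  exact ha (.inr ⟨j, j.2, by simp⟩)

variable (m) in
theorem subsingleton_of_gt (i : ℕ) (hi : m < i) (Y : ModuleCat.{0} (MvPolynomial (Fin m) A)) :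
    Subsingleton ((localCohomology (originIdeal A m) i).obj Y) := by
  refine localCohomology.subsingleton_obj_of_hasProjectiveDimensionLT _ _ _ fun t ↦ ?_
  obtain ⟨s, hs⟩ := exists_originIdeal_pow_le (LinearMap.ker (polyToPowerQuotient A (m := m) t))
    fun j ↦ ⟨t, X_pow_mem_ker_polyToPowerQuotient A t j⟩
  have hsurj : Function.Surjective (polyToPowerQuotient A (m := m) t) :=
    (Submodule.mkQ_surjective _).comp (polyEquiv A).surjective
  refine ⟨max t s, LinearMap.ker (polyToPowerQuotient A t), le_max_left _ _,
    (Ideal.pow_le_pow_right (le_max_right _ _)).trans hs, ker_polyToPowerQuotient_le A t, ?_⟩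
  have := hasProjectiveDimensionLT_powerQuotient A t m le_rfl
  have := hasProjectiveDimensionLT_of_ge (powerQuotient A (m := m) t m) (m + 1) i (by lia)
  exact hasProjectiveDimensionLT_of_iso
    ((polyToPowerQuotient A t).quotKerEquivOfSurjective hsurj).symm.toModuleIso i

end LaurentPoly

namespace LaurentPoly

variable (A : Type) [CommRing A] (m : ℕ)

/-- The exponent `-(a + 1)`. -/
def negExponent (a : Fin m → ℕ) : Fin m → ℤ := fun i ↦ -((a i : ℤ) + 1)

lemma negExponent_injective : Function.Injective (negExponent m) := by
  intro a b h
  funext i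
  simpa [negExponent] using congrFun h i

/-- The coefficients at monomials all of whose exponents are negative. -/
def negCoeff : AddMonoidAlgebra A (Fin m → ℤ) →ₗ[A] ((Fin m → ℕ) →₀ A) :=
  Finsupp.lcomapDomain _ (negExponent_injective m) ∘ₗ
    (AddMonoidAlgebra.coeffLinearEquiv A).toLinearMap

variable {A m} in
lemma negCoeff_apply (f : AddMonoidAlgebra A (Fin m → ℤ)) (a : Fin m → ℕ) :
    negCoeff A m f a = f.coeff (negExponent m a) := rfl

lemma negCoeff_single (a : Fin m → ℕ) (c : A) :
    negCoeff A m (AddMonoidAlgebra.single (negExponent m a) c) = Finsupp.single a c := by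
  classical
  ext b
  rw [negCoeff_apply, AddMonoidAlgebra.coeff_single, Finsupp.single_apply, Finsupp.single_apply]
  simp [(negExponent_injective m).eq_iff]

variable {A m} in
lemma negCoeff_eq_zero_iff (f : AddMonoidAlgebra A (Fin m → ℤ)) :
    negCoeff A m f = 0 ↔ f ∈ supported A (someGeBefore m 0 m) := by
  refine ⟨fun h a ha ↦ ?_, fun h ↦ ?_⟩
  · simp only [mem_someGeBefore, lt_irrefl, Fin.is_lt, true_and, false_or, not_exists,
      not_le] at ha
    have : a = negExponent m fun i ↦ (-(a i) - 1).toNat := by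
      funext i
      have := ha i
      simp only [negExponent]
      lia
    rw [this, ← negCoeff_apply, h, Finsupp.zero_apply]
  · ext a
    rw [negCoeff_apply, h, Finsupp.zero_apply]
    simp [mem_someGeBefore, negExponent]
    lia

/-- The top local cohomology is free on the monomials with negative exponents. -/
def subquotientEquiv : Subquotient A (nonnegFrom m m) (someGeBefore m 0 m) ≃ₗ[A]
    ((Fin m → ℕ) →₀ A) :=
  let φ : supported A (nonnegFrom m m) →ₗ[A] ((Fin m → ℕ) →₀ A) :=
    negCoeff A m ∘ₗ (supported A (nonnegFrom m m)).subtype.restrictScalars A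
  have hφ : LinearMap.ker φ = ((supported A (someGeBefore m 0 m)).submoduleOf
      (supported A (nonnegFrom m m))).restrictScalars A := by
    ext x
    exact negCoeff_eq_zero_iff x.1
  have hsurj : Function.Surjective φ := by
    intro x
    induction x using Finsupp.induction_linear with
    | zero => exact ⟨0, map_zero _⟩
    | add x y hx hy =>
      obtain ⟨x, rfl⟩ := hx
      obtain ⟨y, rfl⟩ := hy
      exact ⟨x + y, map_add _ _ _⟩
    | single a c =>
      exact ⟨⟨AddMonoidAlgebra.single (negExponent m a) c, fun b hb ↦
        absurd (fun i hi ↦ absurd i.2 (by lia)) hb⟩, negCoeff_single A m a c⟩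
  (Submodule.Quotient.restrictScalarsEquiv A _).symm ≪≫ₗ
    Submodule.quotEquivOfEq _ _ hφ.symm ≪≫ₗ φ.quotKerEquivOfSurjective hsurj

/-- The inverse monomial `∏ xⱼ^{-(aⱼ+1)}` in the localization. -/
def inverseMonomial (a : Fin m → ℕ) : Localization
    (Submonoid.closure (Set.range (X : Fin m → MvPolynomial (Fin m) A))) :=
  Localization.mk 1 ⟨∏ j : Fin m, X j ^ (a j + 1), Submonoid.prod_mem _ fun j _ ↦
    Submonoid.pow_mem _ (Submonoid.subset_closure (Set.mem_range_self j)) _⟩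

lemma isUnit_algebraMap (y : Submonoid.closure (Set.range (X : Fin m → MvPolynomial (Fin m) A))) :
    IsUnit (algebraMap (MvPolynomial (Fin m) A) (AddMonoidAlgebra A (Fin m → ℤ)) y) := by
  suffices Submonoid.closure (Set.range X) ≤ (IsUnit.submonoid _).comap
    (algebraMap (MvPolynomial (Fin m) A) (AddMonoidAlgebra A (Fin m → ℤ))) from this y.2
  rw [Submonoid.closure_le]
  rintro _ ⟨i, rfl⟩
  change IsUnit (algebraMap _ _ (X i))
  rw [algebraMap_X]
  refine IsUnit.of_mul_eq_one (AddMonoidAlgebra.single (-Pi.single i 1) 1) ?_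
  rw [AddMonoidAlgebra.single_mul_single, add_neg_cancel, one_mul, AddMonoidAlgebra.one_def]

/-- The map from the localization to the Laurent polynomial ring. -/
def localizationMap : Localization
    (Submonoid.closure (Set.range (X : Fin m → MvPolynomial (Fin m) A))) →ₐ[MvPolynomial (Fin m) A]
      AddMonoidAlgebra A (Fin m → ℤ) :=
  IsLocalization.liftAlgHom (M := Submonoid.closure (Set.range X)) (f := Algebra.ofId _ _)
    (isUnit_algebraMap A m)

lemma localizationMap_inverseMonomial (a : Fin m → ℕ) :
    localizationMap A m (inverseMonomial A m a) =
      AddMonoidAlgebra.single (negExponent m a) 1 := by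
  have h : algebraMap (MvPolynomial (Fin m) A) (AddMonoidAlgebra A (Fin m → ℤ))
      (∏ j : Fin m, X j ^ (a j + 1)) = AddMonoidAlgebra.single (-negExponent m a) 1 := by
    rw [map_prod]
    simp_rw [algebraMap_X_pow]
    rw [AddMonoidAlgebra.prod_single, Finset.prod_const_one,
      Finset.univ_sum_single (fun i ↦ ((a i + 1 : ℕ) : ℤ))]
    congr 1
  have h2 : (∏ j : Fin m, X j ^ (a j + 1) : MvPolynomial (Fin m) A) •
      inverseMonomial A m a = 1 := by
    rw [inverseMonomial, Localization.mk_eq_mk', Algebra.smul_def]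
    exact (IsLocalization.mk'_spec' _ _ (⟨_, _⟩ : Submonoid.closure _)).trans
      (map_one (algebraMap (MvPolynomial (Fin m) A) _))
  have h3 := congrArg (localizationMap A m) h2
  rw [map_smul, map_one, Algebra.smul_def, h] at h3
  have h4 : AddMonoidAlgebra.single (-negExponent m a) (1 : A) *
      AddMonoidAlgebra.single (negExponent m a) 1 = 1 := by
    rw [AddMonoidAlgebra.single_mul_single, neg_add_cancel, one_mul, AddMonoidAlgebra.one_def]
  exact (IsUnit.of_mul_eq_one _ h4).mul_left_cancel (h3.trans h4.symm)

lemma linearIndependent_inverseMonomial : LinearIndependent A (inverseMonomial A m) := by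
  refine LinearIndependent.of_comp
    (negCoeff A m ∘ₗ ((localizationMap A m).toLinearMap.restrictScalars A)) ?_
  have : (negCoeff A m ∘ₗ ((localizationMap A m).toLinearMap.restrictScalars A)) ∘
      inverseMonomial A m = fun a ↦ Finsupp.single a 1 := by
    funext a
    exact (congrArg (negCoeff A m) (localizationMap_inverseMonomial A m a)).trans
      (negCoeff_single A m a 1)
  rw [this]
  exact Finsupp.linearIndependent_single_one _ _

end LaurentPoly

end

/-- for `B = A[x_1,…,x_m]` and `I = (x_1,…,x_m)`, the local cohomology
`H^i_I(B)` vanishes for `i ≠ m`, and `H^m_I(B)` is isomorphic (as an `A`-module) to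
`(1/(x_1⋯x_m))·A[1/x_1,…,1/x_m]`, the `A`-span of the monomials
`x_1^{-a_1}⋯x_m^{-a_m}` with all `a_i ≥ 1` inside the localization of `B` at the
`x_i`. -/
theorem stmt_13 (A : Type) [CommRing A] (m : ℕ) :
    (∀ i : ℕ, i ≠ m →
      Subsingleton
        ((localCohomology
          (Ideal.span (Set.range (MvPolynomial.X : Fin m → MvPolynomial (Fin m) A))) i).obj
            (ModuleCat.of (MvPolynomial (Fin m) A) (MvPolynomial (Fin m) A)))) ∧
    Nonempty
      (((ModuleCat.restrictScalars
            (algebraMap A (MvPolynomial (Fin m) A))).obj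
          ((localCohomology
            (Ideal.span (Set.range (MvPolynomial.X : Fin m → MvPolynomial (Fin m) A))) m).obj
              (ModuleCat.of (MvPolynomial (Fin m) A) (MvPolynomial (Fin m) A))))
        ≃ₗ[A]
      (Submodule.span A
        {y : Localization
            (Submonoid.closure (Set.range (MvPolynomial.X : Fin m → MvPolynomial (Fin m) A))) |
          ∃ a : Fin m → ℕ,
            y = Localization.mk 1
              ⟨∏ j : Fin m, MvPolynomial.X j ^ (a j + 1), by
                exact Submonoid.prod_mem _ fun j _ =>
                  Submonoid.pow_mem _ (Submonoid.subset_closure (Set.mem_range_self j)) _⟩})) := by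
  refine ⟨fun i hi ↦ hi.lt_or_gt.elim (LaurentPoly.subsingleton_of_lt A m i)
    fun h ↦ LaurentPoly.subsingleton_of_gt A m i h _, ?_⟩
  obtain ⟨e⟩ := LaurentPoly.nonempty_linearEquiv A m
  let e' : ((ModuleCat.restrictScalars (algebraMap A (MvPolynomial (Fin m) A))).obj
      ((localCohomology (LaurentPoly.originIdeal A m) m).obj
        (ModuleCat.of _ (MvPolynomial (Fin m) A)))) ≃ₗ[A]
      LaurentPoly.Subquotient A (LaurentPoly.nonnegFrom m m) (LaurentPoly.someGeBefore m 0 m) :=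
    { e.toAddEquiv with
      map_smul' := fun c x ↦ (e.map_smul (algebraMap A _ c) x).trans (algebraMap_smul _ c _) }
  refine ⟨e' ≪≫ₗ LaurentPoly.subquotientEquiv A m ≪≫ₗ
    (LaurentPoly.linearIndependent_inverseMonomial A m).linearCombinationEquiv ≪≫ₗ
      LinearEquiv.ofEq _ _ (congrArg _ ?_)⟩
  ext y
  exact exists_congr fun _ ↦ eq_comm

end
end
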